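/- A weakly shrewd cardinal κ is not shrewd if and only if there exists a cardinal δ > κ such that the singleton {δ} is definable by a Σ₂-formula with parameters in H(κ). -/

import Mathlib

universe u

open Cardinal

/-- Formulas of the language of set theory with an additional unary predicate
symbol `pred`; variables are indexed by natural numbers. -/
inductive SF : Type
  | mem : ℕ → ℕ → SF
  | eq : ℕ → ℕ → SF
  | pred : ℕ → SF
  | not : SF → SF
  | and : SF → SF → SF
  | ex : ℕ → SF → SF

/-- The free variables of a formula. -/
def SF.fv : SF → Set ℕ
  | .mem i j => {i, j}
  | .eq i j => {i, j}
  | .pred i => {i}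
  | .not φ => φ.fv
  | .and φ ψ => φ.fv ∪ ψ.fv
  | .ex k φ => φ.fv \ {k}

/-- Tarskian satisfaction of a formula in the structure whose carrier is the
class `S`, where the membership symbol is interpreted by the binary relation `E`
and the extra unary predicate symbol by the class `P`, under the valuation `v`. -/
def Sat (P : Set ZFSet.{u}) (E : ZFSet.{u} → ZFSet.{u} → Prop) (S : Set ZFSet.{u}) :
    SF → (ℕ → ZFSet.{u}) → Prop
  | .mem i j, v => E (v i) (v j)
  | .eq i j, v => v i = v j
  | .pred i, v => v i ∈ P
  | .not φ, v => ¬ Sat P E S φ v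
  | .and φ ψ, v => Sat P E S φ v ∧ Sat P E S ψ v
  | .ex k φ, v => ∃ x, x ∈ S ∧ Sat P E S φ (Function.update v k x)

/-- Satisfaction in the `∈`-structure with carrier `S`, the predicate symbol
being interpreted by the class `R`. -/
def SatIn (R : Set ZFSet.{u}) (S : Set ZFSet.{u}) (φ : SF) (v : ℕ → ZFSet.{u}) : Prop :=
  Sat R (· ∈ ·) S φ v

/-- Δ₀-formulas: built from atomic formulas by propositional connectives and
bounded existential quantification. -/
inductive IsDeltaZero : SF → Prop
  | mem (i j) : IsDeltaZero (.mem i j)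
  | eq (i j) : IsDeltaZero (.eq i j)
  | pred (i) : IsDeltaZero (.pred i)
  | not {φ} : IsDeltaZero φ → IsDeltaZero (.not φ)
  | and {φ ψ} : IsDeltaZero φ → IsDeltaZero ψ → IsDeltaZero (.and φ ψ)
  | bex {φ} (k j) : IsDeltaZero φ → IsDeltaZero (.ex k (.and (.mem k j) φ))

mutual
  /-- Σₙ-formulas of the Lévy hierarchy. -/
  inductive IsSigma : ℕ → SF → Prop
    | of_zero {φ} : IsDeltaZero φ → IsSigma 0 φ
    | of_pi {n φ} : IsPi n φ → IsSigma (n + 1) φ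
    | ex {n φ} (k) : IsSigma (n + 1) φ → IsSigma (n + 1) (.ex k φ)
  /-- Πₙ-formulas of the Lévy hierarchy. -/
  inductive IsPi : ℕ → SF → Prop
    | of_zero {φ} : IsDeltaZero φ → IsPi 0 φ
    | not {n φ} : IsSigma (n + 1) φ → IsPi (n + 1) (.not φ)
end

/-- The valuation sending `v₀` to `a`, `v₁` to `b` and all other variables to `∅`. -/
def val2 (a b : ZFSet.{u}) : ℕ → ZFSet.{u} := fun i => if i = 0 then a else if i = 1 then b else ∅

/-- `x` is a (von Neumann) ordinal. -/
def ZOrd (x : ZFSet.{u}) : Prop := x.IsTransitive ∧ ∀ y ∈ x, ZFSet.IsTransitive y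

/-- `κ` is a (von Neumann) cardinal. -/
def ZCard (κ : ZFSet.{u}) : Prop := ZOrd κ ∧ ∀ β ∈ κ, #β.toSet < #κ.toSet

/-- `κ` is an infinite cardinal. -/
def InfCard (κ : ZFSet.{u}) : Prop := ZCard κ ∧ ZFSet.omega ⊆ κ

/-- `κ` is an infinite regular cardinal: every cofinal subset of `κ` has
cardinality `κ`. -/
def ZRegular (κ : ZFSet.{u}) : Prop :=
  InfCard κ ∧ ∀ x : ZFSet.{u}, x ⊆ κ →
    (∀ β ∈ κ, ∃ γ ∈ x, β ∈ γ ∨ β = γ) → #x.toSet = #κ.toSet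

/-- `C` is a closed unbounded (class of) subset(s) of the ordinal `κ`. -/
def ZClub (C : Set ZFSet.{u}) (κ : ZFSet.{u}) : Prop :=
  (∀ γ ∈ C, γ ∈ κ) ∧ (∀ β ∈ κ, ∃ γ ∈ C, β ∈ γ) ∧
    (∀ β ∈ κ, (∃ γ, γ ∈ β) → (∀ γ ∈ β, ∃ δ ∈ C, γ ∈ δ ∧ δ ∈ β) → β ∈ C)

/-- `S` is stationary in `κ`: it meets every closed unbounded subset of `κ`. -/
def ZStationary (S : Set ZFSet.{u}) (κ : ZFSet.{u}) : Prop :=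
  ∀ C, ZClub C κ → ∃ γ ∈ C, γ ∈ S

/-- `H(θ)`: the class of all sets hereditarily of cardinality less than `θ`. -/
def HSet (θ : ZFSet.{u}) : Set ZFSet.{u} :=
  {x | ∃ t : ZFSet.{u}, t.IsTransitive ∧ x ⊆ t ∧ #t.toSet < #θ.toSet}

/-- `θ` is the cardinal successor `κ⁺` of `κ`. -/
def SuccCardOf (θ κ : ZFSet.{u}) : Prop :=
  ZCard θ ∧ κ ∈ θ ∧ ∀ μ, ZCard μ → κ ∈ μ → θ ⊆ μ

/-- `κ` is a weakly shrewd cardinal. -/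
def WeaklyShrewd (κ : ZFSet.{u}) : Prop :=
  InfCard κ ∧
    ∀ (φ : SF) (θ A : ZFSet.{u}), φ.fv ⊆ {0, 1} → ZCard θ → κ ∈ θ → A ⊆ κ →
      SatIn ∅ (HSet θ) φ (val2 A κ) →
      ∃ κ' θ' : ZFSet.{u}, ZCard κ' ∧ ZCard θ' ∧ κ' ∈ θ' ∧ κ' ∈ κ ∧
        SatIn ∅ (HSet θ') φ (val2 (A ∩ κ') κ')

/-- `j` is an elementary embedding of the `∈`-structure (with predicate `R`)
with carrier `X` into the one with carrier `Y`. -/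
def ElemEmbOn (R : Set ZFSet.{u}) (X Y : Set ZFSet.{u}) (j : ZFSet.{u} → ZFSet.{u}) : Prop :=
  (∀ x ∈ X, j x ∈ Y) ∧
    ∀ (φ : SF) (v : ℕ → ZFSet.{u}), (∀ i, v i ∈ X) →
      (SatIn R X φ v ↔ SatIn R Y φ (fun i => j (v i)))

/-- `X` is an elementary submodel of `Y` (as `∈`-structures with predicate `R`). -/
def ElemSub (R : Set ZFSet.{u}) (X Y : Set ZFSet.{u}) : Prop :=
  X ⊆ Y ∧ ∀ (φ : SF) (v : ℕ → ZFSet.{u}), (∀ i, v i ∈ X) → (SatIn R X φ v ↔ SatIn R Y φ v)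

/-- `X` is a Σₙ-elementary submodel of `Y`. -/
def SigmaElemSub (R : Set ZFSet.{u}) (n : ℕ) (X Y : Set ZFSet.{u}) : Prop :=
  X ⊆ Y ∧ ∀ (φ : SF), IsSigma n φ → ∀ (v : ℕ → ZFSet.{u}), (∀ i, v i ∈ X) →
    (SatIn R X φ v ↔ SatIn R Y φ v)

/-- The stages of the von Neumann hierarchy, as classes:
`Vclass o` consists of all sets of rank less than `o`. -/
def Vclass (o : Ordinal.{u}) : Set ZFSet.{u} := {x | ZFSet.rank x < o}

/-- The intersection `A ∩ V_c` (for `c` an ordinal). -/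
def Vres (A c : ZFSet.{u}) : ZFSet.{u} :=
  ZFSet.sep (fun y => ZFSet.rank y < ZFSet.rank c) A

/-- `κ` is a shrewd cardinal (Rathjen): for every formula `Φ(v₀,v₁)`, every
ordinal `α` and every `A ⊆ V_κ` such that `Φ(A,κ)` holds in `V_{κ+α}`, there
are ordinals `κ̄, ᾱ < κ` such that `Φ(A ∩ V_κ̄, κ̄)` holds in `V_{κ̄+ᾱ}`. -/
def Shrewd (κ : ZFSet.{u}) : Prop :=
  ZCard κ ∧
    ∀ (φ : SF) (α A : ZFSet.{u}), φ.fv ⊆ {0, 1} → ZOrd α →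
      (∀ y ∈ A, ZFSet.rank y < ZFSet.rank κ) →
      SatIn ∅ (Vclass (ZFSet.rank κ + ZFSet.rank α)) φ (val2 A κ) →
      ∃ κ' α' : ZFSet.{u}, κ' ∈ κ ∧ α' ∈ κ ∧
        SatIn ∅ (Vclass (ZFSet.rank κ' + ZFSet.rank α')) φ (val2 (Vres A κ') κ')

/-! ### Definability framework -/

namespace WS

/-- de Bruijn extension of an environment -/
def cons (x : ZFSet.{u}) (v : ℕ → ZFSet.{u}) : ℕ → ZFSet.{u}
  | 0 => x
  | n + 1 => v n

/-- renaming under a binder -/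
def rcons (a : ℕ) (f : ℕ → ℕ) : ℕ → ℕ
  | 0 => a
  | n + 1 => f n

/-- The first-order definable relations (uniformly in the carrier). -/
inductive Def : (Set ZFSet.{u} → (ℕ → ZFSet.{u}) → Prop) → Prop
  | mem (i j) : Def (fun _ v => v i ∈ v j)
  | eq (i j) : Def (fun _ v => v i = v j)
  | not {R} : Def R → Def (fun S v => ¬ R S v)
  | and {R Q} : Def R → Def Q → Def (fun S v => R S v ∧ Q S v)
  | ex {R} : Def R → Def (fun S v => ∃ x, x ∈ S ∧ R S (cons x v))

theorem Def.ren {R : Set ZFSet.{u} → (ℕ → ZFSet.{u}) → Prop} (h : Def R) :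
    ∀ f : ℕ → ℕ, Def (fun S v => R S (fun i => v (f i))) := by
  induction h with
  | mem i j => intro f; exact .mem _ _
  | eq i j => intro f; exact .eq _ _
  | not _ ih => intro f; exact .not (ih f)
  | and _ _ ih1 ih2 => intro f; exact .and (ih1 f) (ih2 f)
  | @ex R _ ih =>
    intro f
    have := (ih (rcons 0 (fun i => f i + 1))).ex
    have e : ∀ (v : ℕ → ZFSet.{u}) (x : ZFSet.{u}), (cons x fun i => v (f i)) =
        fun i => cons x v (rcons 0 (fun i => f i + 1) i) := by
      intro v x; funext i; cases i <;> rfl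
    simp only [e]
    exact this

/-- translation to named formulas -/
theorem Def.toSF {R : Set ZFSet.{u} → (ℕ → ZFSet.{u}) → Prop} (h : Def R) :
    ∀ (n : ℕ) (ρ : ℕ → ℕ), (∀ i, ρ i < n) → ∃ φ : SF, φ.fv ⊆ Set.range ρ ∧
      ∀ S v, SatIn ∅ S φ v ↔ R S (fun i => v (ρ i)) := by
  induction h with
  | mem i j =>
    intro n ρ _
    refine ⟨.mem (ρ i) (ρ j), ?_, fun S v => Iff.rfl⟩
    rintro k (rfl | rfl) <;> simp
  | eq i j =>
    intro n ρ _
    refine ⟨.eq (ρ i) (ρ j), ?_, fun S v => Iff.rfl⟩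
    rintro k (rfl | rfl) <;> simp
  | not _ ih =>
    intro n ρ h
    obtain ⟨φ, h1, h2⟩ := ih n ρ h
    exact ⟨.not φ, h1, fun S v => not_congr (h2 S v)⟩
  | and _ _ ih1 ih2 =>
    intro n ρ h
    obtain ⟨φ, h1, h2⟩ := ih1 n ρ h
    obtain ⟨ψ, h3, h4⟩ := ih2 n ρ h
    exact ⟨.and φ ψ, Set.union_subset h1 h3, fun S v => and_congr (h2 S v) (h4 S v)⟩
  | @ex R _ ih =>
    intro n ρ h
    obtain ⟨φ, h1, h2⟩ := ih (n + 1) (rcons n ρ) (by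
      intro i; cases i with
      | zero => exact Nat.lt_succ_self n
      | succ i => exact (h i).trans (Nat.lt_succ_self n))
    refine ⟨.ex n φ, ?_, fun S v => ?_⟩
    · rintro k ⟨hk, hk'⟩
      obtain ⟨i, rfl⟩ := h1 hk
      cases i with
      | zero => exact absurd rfl hk'
      | succ i => exact ⟨i, rfl⟩
    · refine exists_congr fun x => and_congr Iff.rfl ((h2 S _).trans ?_)
      have : (fun i => Function.update v n x (rcons n ρ i)) = cons x (fun i => v (ρ i)) := by
        funext i
        cases i with
        | zero => simp [rcons, cons]
        | succ i => simp [rcons, cons, Function.update_of_ne (h i).ne]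
      rw [this]

/-- translation to Δ₀ formulas, the carrier being a set -/
theorem Def.toDelta {R : Set ZFSet.{u} → (ℕ → ZFSet.{u}) → Prop} (h : Def R) :
    ∀ (n : ℕ) (ρ : ℕ → ℕ) (c : ℕ), (∀ i, ρ i < n) → c < n →
      ∃ φ : SF, IsDeltaZero φ ∧ φ.fv ⊆ Set.range ρ ∪ {c} ∧
      ∀ v, SatIn ∅ Set.univ φ v ↔ R {y | y ∈ v c} (fun i => v (ρ i)) := by
  induction h with
  | mem i j =>
    intro n ρ c _ _
    refine ⟨.mem (ρ i) (ρ j), .mem _ _, ?_, fun v => Iff.rfl⟩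
    rintro k (rfl | rfl) <;> simp
  | eq i j =>
    intro n ρ c _ _
    refine ⟨.eq (ρ i) (ρ j), .eq _ _, ?_, fun v => Iff.rfl⟩
    rintro k (rfl | rfl) <;> simp
  | not _ ih =>
    intro n ρ c h hc
    obtain ⟨φ, h0, h1, h2⟩ := ih n ρ c h hc
    exact ⟨.not φ, .not h0, h1, fun v => not_congr (h2 v)⟩
  | and _ _ ih1 ih2 =>
    intro n ρ c h hc
    obtain ⟨φ, h0, h1, h2⟩ := ih1 n ρ c h hc
    obtain ⟨ψ, h0', h3, h4⟩ := ih2 n ρ c h hc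
    exact ⟨.and φ ψ, .and h0 h0', Set.union_subset h1 h3,
      fun v => and_congr (h2 v) (h4 v)⟩
  | @ex R _ ih =>
    intro n ρ c h hc
    obtain ⟨φ, h0, h1, h2⟩ := ih (n + 1) (rcons n ρ) c (by
      intro i; cases i with
      | zero => exact Nat.lt_succ_self n
      | succ i => exact (h i).trans (Nat.lt_succ_self n)) (hc.trans (Nat.lt_succ_self n))
    refine ⟨.ex n (.and (.mem n c) φ), .bex _ _ h0, ?_, fun v => ?_⟩
    · rintro k ⟨hk, hk'⟩
      rcases hk with (rfl | rfl) | hk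
      · exact absurd rfl hk'
      · right; rfl
      · rcases h1 hk with ⟨i, rfl⟩ | rfl
        · cases i with
          | zero => exact absurd rfl hk'
          | succ i => exact Or.inl ⟨i, rfl⟩
        · right; rfl
    · have key : ∀ x, (fun i => Function.update v n x (rcons n ρ i)) =
          cons x (fun i => v (ρ i)) := by
        intro x
        funext i
        cases i with
        | zero => simp [rcons, cons]
        | succ i => simp [rcons, cons, Function.update_of_ne (h i).ne]
      have hcx : ∀ x, Function.update v n x c = v c := fun x =>
        Function.update_of_ne hc.ne _ _
      refine exists_congr fun x => ?_
      have := h2 (Function.update v n x)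
      rw [key, hcx] at this
      simp only [Set.mem_univ, true_and]
      refine and_congr ?_ this
      show Function.update v n x n ∈ Function.update v n x c ↔ _
      rw [hcx, Function.update_self]; rfl

/-- Transitive carriers closed under subsets. -/
def TC (S : Set ZFSet.{u}) : Prop :=
  (∀ x ∈ S, ∀ y ∈ x, y ∈ S) ∧ ∀ x ∈ S, ∀ y, y ⊆ x → y ∈ S

/-- definability over the structures in the class `K`. -/
def Dfn (K : Set ZFSet.{u} → Prop) (R : Set ZFSet.{u} → (ℕ → ZFSet.{u}) → Prop) : Prop :=
  ∃ R', Def R' ∧ ∀ S, K S → ∀ v : ℕ → ZFSet.{u}, (∀ i, v i ∈ S) → (R' S v ↔ R S v)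

section
variable {K : Set ZFSet.{u} → Prop} {R Q : Set ZFSet.{u} → (ℕ → ZFSet.{u}) → Prop}

theorem Dfn.congr (h : Dfn K R)
    (e : ∀ S, K S → ∀ v : ℕ → ZFSet.{u}, (∀ i, v i ∈ S) → (R S v ↔ Q S v)) : Dfn K Q := by
  obtain ⟨R', h1, h2⟩ := h
  exact ⟨R', h1, fun S hS v hv => (h2 S hS v hv).trans (e S hS v hv)⟩

theorem Dfn.mono {K' : Set ZFSet.{u} → Prop} (h : Dfn K R) (e : ∀ S, K' S → K S) : Dfn K' R := by
  obtain ⟨R', h1, h2⟩ := h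
  exact ⟨R', h1, fun S hS v hv => h2 S (e S hS) v hv⟩

theorem Dfn.of (h : Def R) : Dfn K R := ⟨R, h, fun _ _ _ _ => Iff.rfl⟩

theorem Dfn.mem (i j) : Dfn K (fun _ v => v i ∈ v j) := .of (.mem i j)
theorem Dfn.eq (i j) : Dfn K (fun _ v => v i = v j) := .of (.eq i j)

theorem Dfn.not (h : Dfn K R) : Dfn K (fun S v => ¬ R S v) := by
  obtain ⟨R', h1, h2⟩ := h
  exact ⟨_, h1.not, fun S hS v hv => not_congr (h2 S hS v hv)⟩

theorem Dfn.and (h : Dfn K R) (h' : Dfn K Q) : Dfn K (fun S v => R S v ∧ Q S v) := by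
  obtain ⟨R', h1, h2⟩ := h
  obtain ⟨Q', h3, h4⟩ := h'
  exact ⟨_, h1.and h3, fun S hS v hv => and_congr (h2 S hS v hv) (h4 S hS v hv)⟩

theorem Dfn.or (h : Dfn K R) (h' : Dfn K Q) : Dfn K (fun S v => R S v ∨ Q S v) :=
  (h.not.and h'.not).not.congr fun S _ v _ => by tauto

theorem Dfn.imp (h : Dfn K R) (h' : Dfn K Q) : Dfn K (fun S v => R S v → Q S v) :=
  (h.and h'.not).not.congr fun S _ v _ => by tauto

theorem Dfn.iff (h : Dfn K R) (h' : Dfn K Q) : Dfn K (fun S v => (R S v ↔ Q S v)) :=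
  ((h.imp h').and (h'.imp h)).congr fun S _ v _ => by tauto

theorem cons_mem {S : Set ZFSet.{u}} {v : ℕ → ZFSet.{u}} {x} (hx : x ∈ S) (hv : ∀ i, v i ∈ S) :
    ∀ i, cons x v i ∈ S := by
  intro i; cases i
  · exact hx
  · exact hv _

theorem Dfn.ex (h : Dfn K R) : Dfn K (fun S v => ∃ x ∈ S, R S (cons x v)) := by
  obtain ⟨R', h1, h2⟩ := h
  exact ⟨_, h1.ex, fun S hS v hv => exists_congr fun x =>
    and_congr_right fun hx => h2 S hS _ (cons_mem hx hv)⟩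

theorem Dfn.all (h : Dfn K R) : Dfn K (fun S v => ∀ x ∈ S, R S (cons x v)) :=
  h.not.ex.not.congr fun S _ v _ => by push Not; rfl

theorem Dfn.bex (hK : ∀ S, K S → TC S) (i : ℕ) (h : Dfn K R) :
    Dfn K (fun S v => ∃ x ∈ v i, R S (cons x v)) :=
  ((Dfn.mem 0 (i + 1)).and h).ex.congr fun S hS v hv =>
    ⟨fun ⟨x, _, h1, h2⟩ => ⟨x, h1, h2⟩,
      fun ⟨x, h1, h2⟩ => ⟨x, (hK S hS).1 _ (hv i) _ h1, h1, h2⟩⟩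

theorem Dfn.ball (hK : ∀ S, K S → TC S) (i : ℕ) (h : Dfn K R) :
    Dfn K (fun S v => ∀ x ∈ v i, R S (cons x v)) :=
  (h.not.bex hK i).not.congr fun S _ v _ => by push Not; rfl

theorem Dfn.ren (h : Dfn K R) (f : ℕ → ℕ) : Dfn K (fun S v => R S (fun i => v (f i))) := by
  obtain ⟨R', h1, h2⟩ := h
  exact ⟨_, h1.ren f, fun S hS v hv => h2 S hS _ fun i => hv _⟩
end

/-- the two-variable environment -/
def env2 (a b : ZFSet.{u}) : ℕ → ZFSet.{u} := cons a (fun _ => b)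

theorem env2_mem {S : Set ZFSet.{u}} {a b} (ha : a ∈ S) (hb : b ∈ S) : ∀ i, env2 a b i ∈ S :=
  cons_mem ha fun _ => hb

/-- extraction of a formula with two free variables. -/
theorem Dfn.formula {R : Set ZFSet.{u} → (ℕ → ZFSet.{u}) → Prop} (h : Dfn TC R) :
    ∃ φ : SF, φ.fv ⊆ {0, 1} ∧ ∀ S, TC S → ∀ a b,
      (SatIn ∅ S φ (val2 a b) ↔ a ∈ S ∧ b ∈ S ∧ R S (env2 a b)) := by
  obtain ⟨R', h1, h2⟩ := h
  have e0 : Def.{u} (fun S v => ∃ x, x ∈ S ∧ x = v 0) := (Def.eq 0 1).ex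
  have e1 : Def.{u} (fun S v => ∃ x, x ∈ S ∧ x = v 1) := (Def.eq 0 2).ex
  obtain ⟨φ, h3, h4⟩ := (e0.and (e1.and h1)).toSF 2 (rcons 0 fun _ => 1)
    (by intro i; cases i <;> simp [rcons])
  refine ⟨φ, ?_, ?_⟩
  · intro k hk
    obtain ⟨i, rfl⟩ := h3 hk
    cases i <;> simp [rcons]
  · intro S hS a b
    rw [h4]
    have : (fun i => val2 a b (rcons 0 (fun _ => 1) i)) = env2 a b := by
      funext i; cases i <;> simp [rcons, env2, cons, val2]
    rw [this]
    constructor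
    · rintro ⟨⟨_, ha, rfl⟩, ⟨_, hb, rfl⟩, h⟩
      exact ⟨ha, hb, (h2 S hS _ (env2_mem ha hb)).1 h⟩
    · rintro ⟨ha, hb, h⟩
      exact ⟨⟨_, ha, rfl⟩, ⟨_, hb, rfl⟩, (h2 S hS _ (env2_mem ha hb)).2 h⟩

/-- extraction of a Σ₂-formula with two free variables. -/
theorem Dfn.sigma2 {R : Set ZFSet.{u} → (ℕ → ZFSet.{u}) → Prop} (h : Dfn TC R) :
    ∃ φ : SF, φ.fv ⊆ {0, 1} ∧ IsSigma 2 φ ∧ ∀ a b,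
      (SatIn ∅ Set.univ φ (val2 a b) ↔
        ∃ U : ZFSet.{u}, TC {y | y ∈ U} ∧ a ∈ U ∧ b ∈ U ∧ R {y | y ∈ U} (env2 a b)) := by
  obtain ⟨R', h1, h2⟩ := h
  obtain ⟨φ, h0, h3, h4⟩ := h1.toDelta 4 (rcons 0 fun _ => 1) 2
    (by intro i; cases i <;> simp [rcons]) (by norm_num)
  let tr : SF := .not (.ex 4 (.and (.mem 4 2) (.ex 5 (.and (.mem 5 4) (.not (.mem 5 2))))))
  let sb : SF := .not (.ex 4 (.and (.mem 4 2) (.and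
    (.not (.ex 5 (.and (.mem 5 3) (.not (.mem 5 4))))) (.not (.mem 3 2)))))
  let body : SF := .and tr (.and sb (.and (.mem 0 2) (.and (.mem 1 2) φ)))
  have htr : IsDeltaZero tr := .not (.bex _ _ (.bex _ _ (.not (.mem _ _))))
  have hsb : IsDeltaZero sb :=
    .not (.bex _ _ (.and (.not (.bex _ _ (.not (.mem _ _)))) (.not (.mem _ _))))
  have hbody : IsDeltaZero body := .and htr (.and hsb (.and (.mem _ _) (.and (.mem _ _) h0)))
  refine ⟨.ex 2 (.not (.ex 3 (.not body))), ?_, ?_, ?_⟩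
  · intro k hk
    simp only [SF.fv, body, tr, sb] at hk
    by_cases hφ : k ∈ φ.fv
    · rcases h3 hφ with ⟨i, rfl⟩ | rfl
      · cases i <;> simp [rcons]
      · simp at hk
    · simp only [Set.mem_sdiff, Set.mem_union, Set.mem_singleton_iff, Set.mem_insert_iff, hφ,
        or_false] at hk ⊢
      omega
  · exact .ex _ (.of_pi (.not (.ex _ (.of_pi (.of_zero (.not hbody))))))
  · intro a b
    have key : ∀ U c, SatIn ∅ Set.univ body
        (Function.update (Function.update (val2 a b) 2 U) 3 c) ↔
        ((∀ x ∈ U, ∀ y ∈ x, y ∈ U) ∧ (∀ x ∈ U, c ⊆ x → c ∈ U) ∧ a ∈ U ∧ b ∈ U ∧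
          R' {y | y ∈ U} (env2 a b)) := by
      intro U c
      have e : SatIn ∅ Set.univ φ (Function.update (Function.update (val2 a b) 2 U) 3 c) ↔
          R' {y | y ∈ U} (env2 a b) := by
        rw [h4]
        have : (fun i => Function.update (Function.update (val2 a b) 2 U) 3 c
            (rcons 0 (fun _ => 1) i)) = env2 a b := by
          funext i; cases i <;> simp [rcons, env2, cons, val2, Function.update]
        rw [this]
        simp [Function.update]
      unfold SatIn at e
      simp only [SatIn, body, tr, sb, Sat, e]
      simp [Function.update, val2, ZFSet.subset_def]
    have unf : SatIn ∅ Set.univ (.ex 2 (.not (.ex 3 (.not body)))) (val2 a b) ↔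
        ∃ U, ∀ c, SatIn ∅ Set.univ body
          (Function.update (Function.update (val2 a b) 2 U) 3 c) := by
      simp [SatIn, Sat]
    rw [unf]
    simp only [key]
    refine exists_congr fun U => ⟨fun h => ?_, fun h c => ?_⟩
    · obtain ⟨t1, -, ha, hb, hR⟩ := h ∅
      have hTC : TC {y | y ∈ U} := ⟨t1, fun x hx y hy => (h y).2.1 x hx hy⟩
      exact ⟨hTC, ha, hb, (h2 _ hTC _ (env2_mem ha hb)).1 hR⟩
    · obtain ⟨t1, ha, hb, hR⟩ := h
      exact ⟨t1.1, fun x hx hy => t1.2 x hx c hy, ha, hb, (h2 _ t1 _ (env2_mem ha hb)).2 hR⟩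

/-- satisfaction depends only on the free variables -/
theorem sat_congr (S : Set ZFSet.{u}) (φ : SF) : ∀ v w : ℕ → ZFSet.{u},
    (∀ i ∈ φ.fv, v i = w i) → (SatIn ∅ S φ v ↔ SatIn ∅ S φ w) := by
  induction φ with
  | mem i j => intro v w h; simp [SatIn, Sat, h i (by simp [SF.fv]), h j (by simp [SF.fv])]
  | eq i j => intro v w h; simp [SatIn, Sat, h i (by simp [SF.fv]), h j (by simp [SF.fv])]
  | pred i => intro v w h; simp [SatIn, Sat]
  | not φ ih => intro v w h; exact not_congr (ih v w h)
  | and φ ψ ih1 ih2 =>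
    intro v w h
    exact and_congr (ih1 v w fun i hi => h i (Or.inl hi)) (ih2 v w fun i hi => h i (Or.inr hi))
  | ex k φ ih =>
    intro v w h
    refine exists_congr fun x => and_congr Iff.rfl (ih _ _ fun i hi => ?_)
    by_cases hik : i = k
    · subst hik; simp
    · rw [Function.update_of_ne hik, Function.update_of_ne hik]; exact h i ⟨hi, hik⟩

theorem Def.sat (φ : SF) : ∀ ρ : ℕ → ℕ,
    Def.{u} (fun S v => SatIn ∅ S φ (fun i => v (ρ i))) := by
  induction φ with
  | mem i j => intro ρ; exact .mem _ _
  | eq i j => intro ρ; exact .eq _ _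
  | pred i =>
    intro ρ
    have : Def.{u} (fun _ v => ¬ (v 0 = v 0)) := .not (.eq 0 0)
    simpa [SatIn, Sat] using this
  | not φ ih => intro ρ; exact .not (ih ρ)
  | and φ ψ ih1 ih2 => intro ρ; exact .and (ih1 ρ) (ih2 ρ)
  | ex k φ ih =>
    intro ρ
    have := (ih (fun i => if i = k then 0 else ρ i + 1)).ex
    have e : ∀ (v : ℕ → ZFSet.{u}) (x : ZFSet.{u}), Function.update (fun i => v (ρ i)) k x =
        (fun i => cons x v (if i = k then 0 else ρ i + 1)) := by
      intro v x
      funext i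
      by_cases hik : i = k
      · subst hik; simp [cons]
      · simp [hik, cons]
    have e' : (fun (S : Set ZFSet.{u}) (v : ℕ → ZFSet.{u}) =>
        SatIn ∅ S (.ex k φ) (fun i => v (ρ i))) = (fun S v => ∃ x, x ∈ S ∧
          SatIn ∅ S φ (fun i => cons x v (if i = k then 0 else ρ i + 1))) := by
      funext S v
      refine propext (exists_congr fun x => ?_)
      rw [e]; rfl
    rw [e']
    exact this

theorem Def.satRel (φ : SF) : ∀ (ρ : ℕ → ℕ) (w : ℕ),
    Def.{u} (fun S v => SatIn ∅ {y | y ∈ S ∧ y ∈ v w} φ (fun i => v (ρ i))) := by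
  induction φ with
  | mem i j => intro ρ w; exact .mem _ _
  | eq i j => intro ρ w; exact .eq _ _
  | pred i =>
    intro ρ w
    have : Def.{u} (fun _ v => ¬ (v 0 = v 0)) := .not (.eq 0 0)
    simpa [SatIn, Sat] using this
  | not φ ih => intro ρ w; exact .not (ih ρ w)
  | and φ ψ ih1 ih2 => intro ρ w; exact .and (ih1 ρ w) (ih2 ρ w)
  | ex k φ ih =>
    intro ρ w
    have := ((Def.mem 0 (w + 1)).and (ih (fun i => if i = k then 0 else ρ i + 1) (w + 1))).ex
    have e : (fun (S : Set ZFSet.{u}) (v : ℕ → ZFSet.{u}) =>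
        SatIn ∅ {y | y ∈ S ∧ y ∈ v w} (.ex k φ) (fun i => v (ρ i))) = (fun S v =>
          ∃ x, x ∈ S ∧ cons x v 0 ∈ cons x v (w + 1) ∧
          SatIn ∅ {y | y ∈ S ∧ y ∈ cons x v (w + 1)} φ
            (fun i => cons x v (if i = k then 0 else ρ i + 1))) := by
      funext S v
      refine propext ?_
      refine exists_congr fun x => ?_
      have hv : Function.update (fun i => v (ρ i)) k x =
          (fun i => cons x v (if i = k then 0 else ρ i + 1)) := by
        funext i
        by_cases hik : i = k
        · subst hik; simp [cons]
        · simp [hik, cons]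
      rw [← hv]
      exact and_assoc
    rw [e]
    exact this

end WS

namespace WS
open ZFSet

/-! ### Nice carriers and absolute notions -/

theorem tcid : ∀ S : Set ZFSet.{u}, TC S → TC S := fun _ h => h

theorem dfn_sub (i j) : Dfn.{u} TC (fun _ v => v i ⊆ v j) :=
  ((Dfn.mem 0 (j + 1)).ball tcid i).congr fun S _ v _ => by
    rw [ZFSet.subset_def]; rfl

theorem pair_iff (x y z : ZFSet.{u}) : z = pair x y ↔ ∃ p ∈ z, ∃ q ∈ z, (∀ w ∈ z, w = p ∨ w = q) ∧
    (x ∈ p ∧ ∀ w ∈ p, w = x) ∧ (x ∈ q ∧ y ∈ q ∧ ∀ w ∈ q, w = x ∨ w = y) := by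
  constructor
  · rintro rfl
    refine ⟨{x}, by simp [pair], {x, y}, by simp [pair], ?_, ?_, ?_⟩ <;> simp [pair]
  · rintro ⟨p, hp, q, hq, h1, ⟨h2, h3⟩, h4, h5, h6⟩
    have e1 : p = {x} := by
      ext w; simp only [mem_singleton]; exact ⟨h3 w, fun h => h ▸ h2⟩
    have e2 : q = {x, y} := by
      ext w; simp only [mem_pair]; refine ⟨h6 w, ?_⟩
      rintro (rfl | rfl) <;> assumption
    ext w
    rw [pair, mem_pair, ← e1, ← e2]
    refine ⟨h1 w, ?_⟩
    rintro (rfl | rfl) <;> assumption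

theorem dfn_pairEq (i j k) : Dfn.{u} TC (fun _ v => v k = pair (v i) (v j)) := by
  have h1 : Dfn.{u} TC (fun _ v => ∀ w ∈ v (k + 2), w = v 1 ∨ w = v 0) :=
    ((Dfn.eq 0 2).or (Dfn.eq 0 1)).ball tcid (k + 2)
  have h2 : Dfn.{u} TC (fun _ v => v (i + 2) ∈ v 1 ∧ ∀ w ∈ v 1, w = v (i + 2)) :=
    (Dfn.mem _ _).and ((Dfn.eq 0 (i + 3)).ball tcid 1)
  have h3 : Dfn.{u} TC (fun _ v => v (i + 2) ∈ v 0 ∧ v (j + 2) ∈ v 0 ∧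
      ∀ w ∈ v 0, w = v (i + 2) ∨ w = v (j + 2)) :=
    (Dfn.mem _ _).and ((Dfn.mem _ _).and
      (((Dfn.eq 0 (i + 3)).or (Dfn.eq 0 (j + 3))).ball tcid 0))
  exact (((h1.and (h2.and h3)).bex tcid (k + 1)).bex tcid k).congr fun S _ v _ =>
    (pair_iff _ _ _).symm

theorem dfn_pairMem (i j k) : Dfn.{u} TC (fun _ v => pair (v i) (v j) ∈ v k) :=
  ((dfn_pairEq (i + 1) (j + 1) 0).bex tcid k).congr fun S _ v _ =>
    ⟨fun ⟨x, h1, h2⟩ => by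
      have h2 : x = pair (v i) (v j) := h2
      exact h2 ▸ h1, fun h => ⟨_, h, rfl⟩⟩

theorem dfn_trans (i) : Dfn.{u} TC (fun _ v => (v i).IsTransitive) :=
  ((dfn_sub 0 (i + 1)).ball tcid i).congr fun S _ v _ => by
    exact ⟨fun h x hx => h x hx, fun h x hx => h x hx⟩

theorem dfn_ord (i) : Dfn.{u} TC (fun _ v => ZOrd (v i)) :=
  (dfn_trans i).and ((dfn_trans 0).ball tcid i)

/-- nice carriers -/
structure Nice (S : Set ZFSet.{u}) : Prop where
  tc : TC S
  pr : ∀ x ∈ S, ∀ y ∈ S, pair x y ∈ S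
  prod : ∀ x ∈ S, ∀ y ∈ S, ZFSet.prod x y ∈ S
  trc : ∀ y ∈ S, ∃ t ∈ S, t.IsTransitive ∧ y ∈ t

theorem dfn_nice : Dfn.{u} TC (fun S _ => Nice S) := by
  have h1 : Dfn.{u} TC (fun S _ => ∀ x ∈ S, ∀ y ∈ S, ∃ z ∈ S, z = pair x y) :=
    (dfn_pairEq 2 1 0).ex.all.all
  have h2 : Dfn.{u} TC (fun S _ => ∀ x ∈ S, ∀ y ∈ S, ∃ z ∈ S, ∀ a ∈ x, ∀ b ∈ y, pair a b ∈ z) :=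
    (((dfn_pairMem 1 0 2).ball tcid 2).ball tcid 2).ex.all.all
  have h3 : Dfn.{u} TC (fun S _ => ∀ y ∈ S, ∃ t ∈ S, t.IsTransitive ∧ y ∈ t) :=
    ((dfn_trans 0).and (Dfn.mem 1 0)).ex.all
  refine (h1.and (h2.and h3)).congr fun S hS v _ => ⟨?_, ?_⟩
  · rintro ⟨a1, a2, a3⟩
    refine ⟨hS, ?_, ?_, a3⟩
    · intro x hx y hy
      obtain ⟨z, hz, rfl⟩ := a1 x hx y hy
      exact hz
    · intro x hx y hy
      obtain ⟨z, hz, h⟩ := a2 x hx y hy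
      refine hS.2 z hz _ fun w hw => ?_
      obtain ⟨a, ha, b, hb, rfl⟩ := mem_prod.1 hw
      exact h a ha b hb
  · intro h
    refine ⟨fun x hx y hy => ⟨_, h.pr x hx y hy, rfl⟩, fun x hx y hy =>
      ⟨_, h.prod x hx y hy, fun a ha b hb => pair_mem_prod.2 ⟨ha, hb⟩⟩, h.trc⟩

theorem Dfn.nice {R : Set ZFSet.{u} → (ℕ → ZFSet.{u}) → Prop} (h : Dfn Nice R) :
    Dfn TC (fun S v => Nice S ∧ R S v) := by
  obtain ⟨R', h1, h2⟩ := h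
  exact (dfn_nice.and (Dfn.of h1)).congr fun S _ v hv =>
    and_congr_right fun hn => h2 S hn v hv

theorem ntc : ∀ S : Set ZFSet.{u}, Nice S → TC S := fun _ h => h.tc

theorem zord_iff (x : ZFSet.{u}) : ZOrd x ↔ x.IsOrdinal := by
  rw [isOrdinal_iff_forall_mem_isTransitive]; rfl

theorem zord_rank {x : ZFSet.{u}} (h : ZOrd x) : (rank x).toZFSet = x :=
  ((zord_iff x).1 h).toZFSet_rank_eq

theorem zord_toZFSet (o : Ordinal.{u}) : ZOrd o.toZFSet :=
  (zord_iff _).2 (ZFSet.isOrdinal_toZFSet o)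

theorem Nice.sep {S : Set ZFSet.{u}} (h : Nice S) {x} (hx : x ∈ S) (p : ZFSet.{u} → Prop) :
    ZFSet.sep p x ∈ S := h.tc.2 x hx _ (sep_subset)

theorem rank_lt_witness {S : Set ZFSet.{u}} (hS : Nice S) {y c : ZFSet.{u}} (hy : y ∈ S)
    (hc : c ∈ S) (ho : ZOrd c) :
    rank y < rank c ↔ ∃ t ∈ S, (t.IsTransitive ∧ y ∈ t) ∧ ∃ f ∈ S,
      (∀ v ∈ t, ∃ b ∈ c, pair v b ∈ f) ∧ ∀ v ∈ t, ∀ w ∈ t, v ∈ w → ∀ b ∈ c, ∀ d ∈ c,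
        pair v b ∈ f → pair w d ∈ f → b ∈ d := by
  constructor
  · intro h
    obtain ⟨t, ht, htt, hyt⟩ := hS.trc y hy
    let t' := ZFSet.sep (fun x => rank x ≤ rank y) t
    have ht' : t' ∈ S := hS.sep ht _
    refine ⟨t', ht', ⟨?_, by simp [t', hyt]⟩,
      ZFSet.sep (fun p => ∃ v, p = pair v (rank v).toZFSet) (ZFSet.prod t' c),
      hS.sep (hS.prod _ ht' _ hc) _, ?_, ?_⟩
    · intro x hx z hz
      simp only [t', mem_sep] at hx ⊢
      exact ⟨htt x hx.1 hz, (rank_lt_of_mem hz).le.trans hx.2⟩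
    · intro v hv
      have : (rank v).toZFSet ∈ c := by
        rw [← zord_rank ho, Ordinal.toZFSet_mem_toZFSet_iff]
        simp only [t', mem_sep] at hv
        exact hv.2.trans_lt h
      exact ⟨_, this, by simp [pair_mem_prod, hv, this]⟩
    · intro v hv w hw hvw b hb d hd h1 h2
      obtain ⟨-, v', e1⟩ := mem_sep.1 h1
      obtain ⟨-, w', e2⟩ := mem_sep.1 h2
      obtain ⟨rfl, rfl⟩ := pair_inj.1 e1
      obtain ⟨rfl, rfl⟩ := pair_inj.1 e2
      rw [Ordinal.toZFSet_mem_toZFSet_iff]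
      exact rank_lt_of_mem hvw
  · rintro ⟨t, -, ⟨htt, hyt⟩, f, -, h1, h2⟩
    have key : ∀ v, v ∈ t → ∀ b ∈ c, pair v b ∈ f → rank v ≤ rank b := by
      intro v
      induction v using ZFSet.inductionOn with
      | _ v ih =>
        intro hv b hb hvb
        rw [rank_le_iff]
        intro w hw
        have hwt := htt v hv hw
        obtain ⟨d, hd, hwd⟩ := h1 w hwt
        exact (ih w hw hwt d hd hwd).trans_lt
          (rank_lt_of_mem (h2 w hwt v hv hw d hd b hb hwd hvb))
    obtain ⟨b, hb, hyb⟩ := h1 y hyt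
    exact (key y hyt b hb hyb).trans_lt (rank_lt_of_mem hb)

theorem dfn_rank (i j) : Dfn.{u} Nice (fun _ v => ZOrd (v j) ∧ rank (v i) < rank (v j)) := by
  have p : ∀ a b c, Dfn.{u} Nice (fun _ v => pair (v a) (v b) ∈ v c) := fun a b c =>
    (dfn_pairMem a b c).mono ntc
  have h1 : Dfn.{u} Nice (fun _ v => ∀ x ∈ v 1, ∃ b ∈ v (j + 2), pair x b ∈ v 0) :=
    ((p 1 0 2).bex ntc (j + 3)).ball ntc 1
  have h2 : Dfn.{u} Nice (fun _ v => ∀ x ∈ v 1, ∀ w ∈ v 1, x ∈ w → ∀ b ∈ v (j + 2),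
      ∀ d ∈ v (j + 2), pair x b ∈ v 0 → pair w d ∈ v 0 → b ∈ d) :=
    (((Dfn.mem 1 0).imp ((((p 3 1 4).imp ((p 2 0 4).imp (Dfn.mem 1 0))).ball ntc (j + 5)).ball
      ntc (j + 4))).ball ntc 2).ball ntc 1
  have h3 := (((((dfn_trans 0).mono ntc).and (Dfn.mem (i + 1) 0)).and (h1.and h2).ex).ex)
  exact (((dfn_ord j).mono ntc).and h3).congr fun S hS v hv =>
    and_congr_right fun ho => (rank_lt_witness hS (hv i) (hv j) ho).symm

theorem card_le_iff (x y : ZFSet.{u}) : card x ≤ card y ↔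
    ∃ f : ZFSet.{u} → ZFSet.{u}, (∀ a ∈ x, f a ∈ y) ∧ ∀ a ∈ x, ∀ b ∈ x, f a = f b → a = b := by
  rw [← Cardinal.lift_le.{u+1}, ← cardinalMk_coe_sort, ← cardinalMk_coe_sort, Cardinal.le_def]
  classical
  constructor
  · rintro ⟨e⟩
    refine ⟨fun a => if h : a ∈ x then (e ⟨a, h⟩ : ZFSet) else ∅, ?_, ?_⟩
    · intro a ha
      simp only [ha, dif_pos]
      exact (e ⟨a, ha⟩).2
    · intro a ha b hb
      simp only [ha, hb, dif_pos]
      intro h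
      have := e.injective (Subtype.ext h)
      exact congrArg Subtype.val this
  · rintro ⟨f, h1, h2⟩
    exact ⟨⟨fun a => ⟨f a.1, h1 a.1 a.2⟩, fun a b h =>
      Subtype.ext (h2 _ a.2 _ b.2 (congrArg Subtype.val h))⟩⟩

theorem card_lt_iff (x y : ZFSet.{u}) : #x.toSet < #y.toSet ↔ card x < card y := by
  rw [← Cardinal.lift_lt.{u,u+1}, ← cardinalMk_coe_sort, ← cardinalMk_coe_sort]
  rfl

theorem dfn_card (i j) : Dfn.{u} Nice (fun _ v => card (v i) ≤ card (v j)) := by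
  have p : ∀ a b c, Dfn.{u} Nice (fun _ v => pair (v a) (v b) ∈ v c) := fun a b c =>
    (dfn_pairMem a b c).mono ntc
  have h1 : Dfn.{u} Nice (fun S v => ∃ f ∈ S, (∀ a ∈ v i, ∃ b ∈ v j, pair a b ∈ f) ∧
      ∀ a ∈ v i, ∀ a' ∈ v i, ∀ b ∈ v j, pair a b ∈ f → pair a' b ∈ f → a = a') :=
    ((((p 1 0 2).bex ntc (j + 2)).ball ntc (i + 1)).and (((((p 2 0 3).imp ((p 1 0 3).imp
      (Dfn.eq 2 1))).ball ntc (j + 3)).ball ntc (i + 2)).ball ntc (i + 1))).ex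
  refine h1.congr fun S hS v hv => ?_
  rw [card_le_iff]
  constructor
  · rintro ⟨f, -, h1, h2⟩
    choose! g hg using h1
    refine ⟨g, fun a ha => (hg a ha).1, fun a ha b hb h => ?_⟩
    exact h2 a ha b hb _ (hg a ha).1 (hg a ha).2 (h ▸ (hg b hb).2)
  · rintro ⟨g, h1, h2⟩
    refine ⟨ZFSet.sep (fun p => ∃ a, p = pair a (g a)) (ZFSet.prod (v i) (v j)),
      hS.sep (hS.prod _ (hv i) _ (hv j)) _, ?_, ?_⟩
    · intro a ha
      exact ⟨g a, h1 a ha, by simp [pair_mem_prod, ha, h1 a ha]⟩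
    · intro a ha a' ha' b hb p1 p2
      obtain ⟨-, w, e1⟩ := mem_sep.1 p1
      obtain ⟨-, w', e2⟩ := mem_sep.1 p2
      obtain ⟨rfl, rfl⟩ := pair_inj.1 e1
      obtain ⟨rfl, e⟩ := pair_inj.1 e2
      exact h2 _ ha _ ha' e

end WS

namespace WS
open ZFSet Order

/-! ### Levels of the hierarchy -/

theorem isV_iff {S : Set ZFSet.{u}} (hS : Nice S) {W g : ZFSet.{u}} (hW : W ∈ S) (hg : ZOrd g) :
    (∀ y ∈ S, y ∈ W ↔ ZOrd g ∧ rank y < rank g) ↔ W = V_ (rank g) := by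
  constructor
  · intro h
    have key : ∀ y : ZFSet.{u}, rank y < rank g → y ∈ W := by
      intro y
      induction y using ZFSet.inductionOn with
      | _ y ih =>
        intro hy
        have hyS : y ∈ S := hS.tc.2 W hW y fun z hz => ih z hz ((rank_lt_of_mem hz).trans hy)
        exact (h y hyS).2 ⟨hg, hy⟩
    ext y
    rw [mem_vonNeumann]
    exact ⟨fun hy => ((h y (hS.tc.1 W hW y hy)).1 hy).2, key y⟩
  · rintro rfl y -
    simp [mem_vonNeumann, hg]

theorem dfn_V (i j) : Dfn.{u} Nice (fun _ v => ZOrd (v j) ∧ v i = V_ (rank (v j))) :=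
  (((dfn_ord j).mono ntc).and ((Dfn.mem 0 (i + 1)).iff (dfn_rank 0 (j + 1))).all).congr
    fun _ hS v hv => and_congr_right fun ho => isV_iff hS (hv i) ho

theorem setOf_V (o : Ordinal.{u}) : {y | y ∈ V_ o} = Vclass o := by
  ext y; exact mem_vonNeumann

theorem dfn_VSat (φ : SF) (hφ : φ.fv ⊆ {0, 1}) (a b g) : Dfn.{u} Nice (fun S v => ZOrd (v g) ∧
    (V_ (rank (v g))) ∈ S ∧ SatIn ∅ (Vclass (rank (v g))) φ (val2 (v a) (v b))) := by
  have h1 : Dfn.{u} Nice (fun S v => SatIn ∅ {y | y ∈ S ∧ y ∈ v 0} φ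
      (fun i => v (if i = 0 then a + 1 else b + 1))) := .of (Def.satRel φ _ 0)
  refine ((dfn_V 0 (g + 1)).and h1).ex.congr fun S hS v hv => ?_
  have e1 : ∀ o : Ordinal.{u}, V_ o ∈ S → {y | y ∈ S ∧ y ∈ V_ o} = Vclass o := by
    intro o ho
    ext y
    rw [Set.mem_setOf_eq, mem_vonNeumann]
    exact ⟨fun h => h.2, fun h => ⟨hS.tc.1 _ ho _ (mem_vonNeumann.2 h), h⟩⟩
  have e2 : ∀ x T, SatIn ∅ T φ (fun i => cons x v (if i = 0 then a + 1 else b + 1)) ↔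
      SatIn ∅ T φ (val2 (v a) (v b)) := by
    intro x T
    refine sat_congr _ _ _ _ fun i hi => ?_
    rcases hφ hi with rfl | h
    · simp [val2, cons]
    · have : i = 1 := h
      subst this
      simp [val2, cons]
  constructor
  · rintro ⟨x, hx, ⟨h1, h2⟩, h3⟩
    have h2 : x = V_ (rank (v g)) := h2
    subst h2
    rw [e2] at h3
    refine ⟨h1, hx, ?_⟩
    rw [← e1 _ hx]
    exact h3
  · rintro ⟨h1, h2, h3⟩
    refine ⟨_, h2, ⟨h1, rfl⟩, ?_⟩
    rw [e2]
    rw [← e1 _ h2] at h3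
    exact h3

/-- strong closure ordinals -/
def Big (β : Ordinal.{u}) : Prop := β ≠ 0 ∧ ∀ γ < β, (succ (card (V_ γ))).ord < β

theorem lt_ordV (γ : Ordinal.{u}) : γ < (succ (card (V_ γ))).ord := by
  rw [lt_ord]
  exact lt_succ_of_le (Ordinal.card_le_card_vonNeumann γ)

theorem exists_big (ρ : Ordinal.{u}) : ∃ β, ρ < β ∧ Big β := by
  let f : Ordinal.{u} → Ordinal.{u} := fun γ => (succ (card (V_ γ))).ord
  have hm : Monotone f := fun a b h => ord_le_ord.2 (succ_le_succ (card_mono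
    (vonNeumann_subset_of_le h)))
  have hlt : ∀ n, f^[n] (succ ρ) < Ordinal.nfp f (succ ρ) := by
    intro n
    refine lt_of_lt_of_le ?_ (Ordinal.iterate_le_nfp f (succ ρ) (n + 1))
    rw [Function.iterate_succ_apply']
    exact lt_ordV _
  refine ⟨Ordinal.nfp f (succ ρ), (lt_succ ρ).trans (hlt 0), ?_, ?_⟩
  · exact (zero_le.trans_lt (hlt 0)).ne'
  · intro γ hγ
    obtain ⟨n, hn⟩ := Ordinal.lt_nfp_iff.1 hγ
    refine lt_of_le_of_lt (hm hn.le) ?_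
    have := hlt (n + 1)
    rwa [Function.iterate_succ_apply'] at this

theorem Big.succ {β : Ordinal.{u}} (h : Big β) {γ} (hγ : γ < β) : succ γ < β :=
  (succ_le_of_lt (lt_ordV γ)).trans_lt (h.2 γ hγ)

theorem Big.card_lt {β : Ordinal.{u}} (h : Big β) {γ} (hγ : γ < β) : card (V_ γ) < β.card := by
  refine (lt_succ _).trans_le ?_
  have := Ordinal.card_le_card (h.2 γ hγ).le
  rwa [card_ord] at this

theorem tc_V (o : Ordinal.{u}) : TC (Vclass o) :=
  ⟨fun _ hx _ hy => (rank_lt_of_mem hy).trans hx, fun _ hx _ hy => (rank_mono hy).trans_lt hx⟩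

theorem tc_H (θ : ZFSet.{u}) : TC (HSet θ) :=
  ⟨fun _ ⟨t, h1, h2, h3⟩ y hy => ⟨t, h1, h1 y (h2 hy), h3⟩,
    fun _ ⟨t, h1, h2, h3⟩ _ hy => ⟨t, h1, fun _ hz => h2 (hy hz), h3⟩⟩

theorem rank_opair_lt {x y : ZFSet.{u}} {o : Ordinal.{u}} (hx : rank x ≤ o) (hy : rank y ≤ o) :
    rank (pair x y) ≤ succ (succ o) := by
  simp only [pair, rank_pair, rank_singleton, sup_le_iff, succ_le_succ_iff]
  exact ⟨hx, hx, hy⟩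

theorem nice_V {β : Ordinal.{u}} (h : ∀ γ < β, succ γ < β) : Nice (Vclass β) where
  tc := tc_V β
  pr x hx y hy := by
    have hm : max (rank x) (rank y) < β := max_lt hx hy
    exact (rank_opair_lt (le_max_left _ _) (le_max_right _ _)).trans_lt (h _ (h _ hm))
  prod x hx y hy := by
    have hm : max (rank x) (rank y) < β := max_lt hx hy
    refine lt_of_le_of_lt (b := succ (succ (succ (max (rank x) (rank y))))) ?_
      (h _ (h _ (h _ hm)))
    rw [rank_le_iff]
    intro w hw
    obtain ⟨a, ha, b, hb, rfl⟩ := mem_prod.1 hw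
    refine (rank_opair_lt ?_ ?_).trans_lt (lt_succ _)
    · exact (rank_lt_of_mem ha).le.trans (le_max_left _ _)
    · exact (rank_lt_of_mem hb).le.trans (le_max_right _ _)
  trc y hy := ⟨V_ (succ (rank y)), by
    show rank _ < β
    rw [rank_vonNeumann]; exact h _ hy, isTransitive_vonNeumann _, mem_vonNeumann_succ y⟩

theorem Big.nice {β : Ordinal.{u}} (h : Big β) : Nice (Vclass β) := nice_V fun _ => h.succ

theorem Big.closed {β : Ordinal.{u}} (h : Big β) : ∀ t ∈ Vclass β, ∃ l ∈ Vclass β,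
    ZOrd l ∧ ¬ card l ≤ card t := by
  intro t ht
  refine ⟨(Order.succ (card (V_ (rank t)))).ord.toZFSet, ?_, zord_toZFSet _, ?_⟩
  · show rank _ < β
    rw [Ordinal.rank_toZFSet]
    exact h.2 _ ht
  · rw [Ordinal.card_toZFSet, card_ord, not_le]
    exact lt_succ_of_le (card_mono (subset_vonNeumann_self t))

theorem zcard_iff (o : Ordinal.{u}) : ZCard o.toZFSet ↔ ∀ γ < o, γ.card < o.card := by
  constructor
  · intro h γ hγ
    have := h.2 _ (Ordinal.toZFSet_mem_toZFSet_iff.2 hγ)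
    rwa [card_lt_iff, Ordinal.card_toZFSet, Ordinal.card_toZFSet] at this
  · intro h
    refine ⟨zord_toZFSet o, fun b hb => ?_⟩
    obtain ⟨γ, hγ, rfl⟩ := Ordinal.mem_toZFSet_iff.1 hb
    rw [card_lt_iff, Ordinal.card_toZFSet, Ordinal.card_toZFSet]
    exact h γ hγ

theorem Big.zcard {β : Ordinal.{u}} (h : Big β) : ZCard β.toZFSet :=
  (zcard_iff β).2 fun γ hγ => (Ordinal.card_le_card_vonNeumann γ).trans_lt (h.card_lt hγ)

theorem trans_rank_surj {t : ZFSet.{u}} (ht : t.IsTransitive) {o : Ordinal.{u}} (ho : o < rank t) :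
    ∃ y ∈ t, rank y = o := by
  obtain ⟨y0, hy0, hoy⟩ := lt_rank_iff.1 ho
  have key : ∀ y : ZFSet.{u}, y ∈ t → o ≤ rank y → ∃ y ∈ t, rank y = o := by
    intro y
    induction y using ZFSet.inductionOn with
    | _ y ih =>
      intro hy hoy
      rcases hoy.eq_or_lt with h | h
      · exact ⟨y, hy, h.symm⟩
      · obtain ⟨z, hz, hoz⟩ := lt_rank_iff.1 h
        exact ih z hz (ht y hy hz) hoz
  exact key y0 hy0 hoy

theorem card_rank_le {t : ZFSet.{u}} (ht : t.IsTransitive) : (rank t).card ≤ card t := by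
  rw [← Ordinal.card_toZFSet, card_le_iff]
  have : ∀ a ∈ (rank t).toZFSet, ∃ y ∈ t, rank y = rank a := by
    intro a ha
    obtain ⟨γ, hγ, rfl⟩ := Ordinal.mem_toZFSet_iff.1 ha
    rw [Ordinal.rank_toZFSet]
    exact trans_rank_surj ht hγ
  choose! f hf using this
  refine ⟨f, fun a ha => (hf a ha).1, fun a ha b hb h => ?_⟩
  have e : rank a = rank b := by rw [← (hf a ha).2, h, (hf b hb).2]
  obtain ⟨γ, hγ, rfl⟩ := Ordinal.mem_toZFSet_iff.1 ha
  obtain ⟨γ', hγ', rfl⟩ := Ordinal.mem_toZFSet_iff.1 hb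
  rw [Ordinal.rank_toZFSet, Ordinal.rank_toZFSet] at e
  rw [e]

theorem Big.hset {β : Ordinal.{u}} (h : Big β) : HSet β.toZFSet = Vclass β := by
  ext x
  constructor
  · rintro ⟨t, h1, h2, h3⟩
    rw [card_lt_iff, Ordinal.card_toZFSet] at h3
    have : (rank t).card < β.card := (card_rank_le h1).trans_lt h3
    have h4 : rank t < β := lt_of_not_ge fun h => this.not_ge (Ordinal.card_le_card h)
    exact (rank_mono h2).trans_lt h4
  · intro hx
    refine ⟨V_ (rank x), isTransitive_vonNeumann _, subset_vonNeumann_self x, ?_⟩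
    rw [card_lt_iff, Ordinal.card_toZFSet]
    exact h.card_lt hx

theorem rank_of_hset {o : Ordinal.{u}} {x : ZFSet.{u}} (h : x ∈ HSet o.toZFSet) : rank x < o := by
  obtain ⟨t, h1, h2, h3⟩ := h
  rw [card_lt_iff, Ordinal.card_toZFSet] at h3
  have : (rank t).card < o.card := (card_rank_le h1).trans_lt h3
  have h4 : rank t < o := lt_of_not_ge fun h => this.not_ge (Ordinal.card_le_card h)
  exact (rank_mono h2).trans_lt h4

/-! ### Producing a definable cardinal -/

/-- the right-hand side of the theorem -/
def RHS (κ : ZFSet.{u}) : Prop := ∃ δ : ZFSet.{u}, ZCard δ ∧ κ ∈ δ ∧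
        ∃ (φ : SF) (z : ZFSet.{u}), φ.fv ⊆ {0, 1} ∧ IsSigma 2 φ ∧ z ∈ HSet κ ∧
          ∀ x : ZFSet.{u}, SatIn ∅ Set.univ φ (val2 x z) ↔ x = δ

theorem lemmaD {R : Set ZFSet.{u} → (ℕ → ZFSet.{u}) → Prop} (hR : Dfn Nice R) {k : Ordinal.{u}}
    {z w0 : ZFSet.{u}} (hz : z ∈ HSet k.toZFSet)
    (ha : ∀ S w, Nice S → w ∈ S → z ∈ S → R S (env2 w z) → w = w0)
    (ρ : Ordinal.{u}) (hb : ∀ β, ρ < β → Big β → R (Vclass β) (env2 w0 z))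
    (hc : k.card ≤ card w0) : RHS k.toZFSet := by
  have h1 : Dfn.{u} Nice (fun S v => ∃ w ∈ S, R S (fun i => cons w v (rcons 0 (fun i => i + 2) i)) ∧
      ZOrd (v 0) ∧ ¬ card (v 0) ≤ card w ∧ ∀ y ∈ v 0, card y ≤ card w) :=
    ((hR.ren _).and (((dfn_ord 1).mono ntc).and
      ((dfn_card 1 0).not.and ((dfn_card 0 1).ball ntc 1)))).ex
  have e : ∀ w x, (fun i => cons w (env2 x z) (rcons 0 (fun i => i + 2) i)) = env2 w z := by
    intro w x
    funext i
    cases i <;> rfl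
  obtain ⟨φ, f1, f2, f3⟩ := h1.nice.sigma2
  set μ : Ordinal.{u} := (succ (card w0)).ord with hμ
  have hlt : ∀ γ < μ, γ.card ≤ card w0 := fun γ hγ => lt_succ_iff.1 (lt_ord.1 hγ)
  refine ⟨μ.toZFSet, ?_, ?_, φ, z, f1, f2, hz, ?_⟩
  · rw [zcard_iff]
    intro γ hγ
    rw [hμ, card_ord]
    exact lt_ord.1 hγ
  · rw [Ordinal.toZFSet_mem_toZFSet_iff, hμ, lt_ord]
    exact lt_succ_of_le hc
  · intro x
    rw [f3]
    constructor
    · rintro ⟨U, -, hx, hzU, hN, w, hw, h1, h2, h3, h4⟩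
      have h2 : ZOrd x := h2
      have h3 : ¬ card x ≤ card w := h3
      have h4 : ∀ y ∈ x, card y ≤ card w := h4
      rw [e] at h1
      obtain rfl := ha _ _ hN hw hzU h1
      rw [← zord_rank h2] at h3 h4 ⊢
      congr 1
      apply le_antisymm
      · refine le_of_not_gt fun h => ?_
        have := h4 _ (Ordinal.toZFSet_mem_toZFSet_iff.2 h)
        rw [Ordinal.card_toZFSet, hμ, card_ord] at this
        exact (lt_succ _).not_ge this
      · rw [hμ, ord_le]
        rw [Ordinal.card_toZFSet, not_le] at h3
        exact succ_le_of_lt h3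
    · rintro rfl
      obtain ⟨β, hβ, hB⟩ := exists_big (max (max ρ μ) (max (rank w0) (rank z)))
      simp only [max_lt_iff] at hβ
      obtain ⟨⟨b1, b2⟩, b3, b4⟩ := hβ
      refine ⟨V_ β, ?_⟩
      simp only [setOf_V, mem_vonNeumann, Ordinal.rank_toZFSet]
      refine ⟨tc_V β, b2, b4, hB.nice, w0, b3, ?_, zord_toZFSet _, ?_, ?_⟩
      · rw [e]; exact hb β b1 hB
      · show ¬ card μ.toZFSet ≤ _
        rw [Ordinal.card_toZFSet, hμ, card_ord, not_le]
        exact lt_succ _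
      · intro y hy
        obtain ⟨γ, hγ, rfl⟩ := Ordinal.mem_toZFSet_iff.1 hy
        rw [Ordinal.card_toZFSet]
        exact hlt γ hγ

/-- Step 1: without definable cardinals, small levels are small. -/
theorem small_V {k : Ordinal.{u}} (hk : ∀ γ < k, γ.card < k.card) (h : ¬ RHS k.toZFSet) :
    ∀ γ < k, card (V_ γ) < k.card := by
  intro γ hγ
  by_contra hc
  rw [not_lt] at hc
  refine h (lemmaD (z := γ.toZFSet) (w0 := V_ γ) (dfn_V 0 1) ?_ ?_ γ ?_ hc)
  · refine ⟨γ.toZFSet, (zord_toZFSet γ).1, fun _ h => h, ?_⟩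
    rw [card_lt_iff, Ordinal.card_toZFSet, Ordinal.card_toZFSet]
    exact hk γ hγ
  · rintro S w - - - ⟨-, h2⟩
    have h2 : w = V_ (rank γ.toZFSet) := h2
    rwa [Ordinal.rank_toZFSet] at h2
  · intro β _ _
    refine ⟨zord_toZFSet γ, ?_⟩
    show V_ γ = V_ (rank γ.toZFSet)
    rw [Ordinal.rank_toZFSet]

theorem hset_of_rank {k : Ordinal.{u}} (hk : ∀ γ < k, card (V_ γ) < k.card) {z : ZFSet.{u}}
    (hz : rank z < k) : z ∈ HSet k.toZFSet := by
  refine ⟨V_ (rank z), isTransitive_vonNeumann _, subset_vonNeumann_self z, ?_⟩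
  rw [card_lt_iff, Ordinal.card_toZFSet]
  exact hk _ hz

end WS

namespace WS
open ZFSet Order

/-! ### Coding -/

/-- infinite initial ordinals -/
structure IC (k : Ordinal.{u}) : Prop where
  inf : Ordinal.omega0 ≤ k
  lt : ∀ γ < k, γ.card < k.card

theorem IC.ord {k : Ordinal.{u}} (h : IC k) : k.card.ord = k := by
  apply le_antisymm (ord_card_le k)
  by_contra hc
  have := h.lt _ (not_le.1 hc)
  rw [card_ord] at this
  exact lt_irrefl _ this

theorem IC.card {k : Ordinal.{u}} (h : IC k) : ℵ₀ ≤ k.card := by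
  have := Ordinal.card_le_card h.inf
  rwa [Ordinal.card_omega0] at this

theorem IC.lt_iff {k : Ordinal.{u}} (h : IC k) {γ} : γ < k ↔ γ.card < k.card :=
  ⟨h.lt γ, fun h' => lt_of_not_ge fun h'' => h'.not_ge (Ordinal.card_le_card h'')⟩

theorem IC.add {k : Ordinal.{u}} (h : IC k) {a b} (ha : a < k) (hb : b < k) : a + b < k := by
  have := Ordinal.isPrincipal_add_ord h.card
  rw [h.ord] at this
  exact this ha hb

theorem IC.mul {k : Ordinal.{u}} (h : IC k) {a b} (ha : a < k) (hb : b < k) : a * b < k := by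
  have := Ordinal.isPrincipal_mul_ord h.card
  rw [h.ord] at this
  exact this ha hb

theorem IC.succ {k : Ordinal.{u}} (h : IC k) {a} (ha : a < k) : succ a < k := by
  rw [Order.succ_eq_add_one]
  exact h.add ha (Ordinal.one_lt_omega0.trans_le h.inf)

theorem exists_pi {k : Ordinal.{u}} (hk : IC k) (hV : ∀ γ < k, card (V_ γ) < k.card) :
    ∃ P : Ordinal.{u} → ZFSet.{u}, (∀ b, ∀ x ∈ P b, ∃ a < b, P a = x) ∧
      (∀ y, rank y < k → ∃ b < k, P b = y) := by
  classical
  let T := Shrink.{u} (V_ k)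
  let val : T → ZFSet.{u} := fun a => ((equivShrink (V_ k)).symm a).1
  let mk : ∀ x : ZFSet.{u}, rank x < k → T := fun x hx => equivShrink (V_ k) ⟨x, mem_vonNeumann.2 hx⟩
  have val_mk : ∀ x hx, val (mk x hx) = x := by intro x hx; simp [val, mk]
  have val_lt : ∀ a, rank (val a) < k := fun a =>
    mem_vonNeumann.1 ((equivShrink (V_ k)).symm a).2
  have val_inj : ∀ a b, val a = val b → a = b := by
    intro a b h
    exact (equivShrink (V_ k)).symm.injective (Subtype.ext h)
  let f : T ↪ Ordinal.{u} × T := ⟨fun a => (rank (val a), a), fun a b h => congrArg Prod.snd h⟩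
  let r : T → T → Prop := f ⁻¹'o (Prod.Lex (· < ·) WellOrderingRel)
  have : IsWellOrder T r := (RelEmbedding.preimage f _).isWellOrder
  have r1 : ∀ a b, rank (val a) < rank (val b) → r a b := fun a b h => Prod.Lex.left _ _ h
  have r2 : ∀ a b, r a b → rank (val a) ≤ rank (val b) := by
    intro a b h
    rcases Prod.lex_def.1 h with h | h
    · exact h.le
    · exact h.1.le
  have hlt : ∀ a : T, Ordinal.typein r a < k := by
    intro a
    rw [hk.lt_iff, Ordinal.card_typein]
    refine lt_of_le_of_lt ?_ (hV _ (hk.succ (val_lt a)))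
    refine Cardinal.mk_le_of_injective (f := fun y => equivShrink (V_ (Order.succ (rank (val a))))
      ⟨val y.1, mem_vonNeumann.2 (lt_succ_of_le (r2 _ _ y.2))⟩) ?_
    intro y z h
    have := (equivShrink _).injective h
    exact Subtype.ext (val_inj _ _ (Subtype.mk.inj this))
  let P : Ordinal.{u} → ZFSet.{u} := fun b =>
    if h : ∃ a : T, Ordinal.typein r a = b then val h.choose else ∅
  have hP : ∀ a : T, P (Ordinal.typein r a) = val a := by
    intro a
    have h : ∃ a' : T, Ordinal.typein r a' = Ordinal.typein r a := ⟨a, rfl⟩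
    simp only [P, dif_pos h]
    congr 1
    exact Ordinal.typein_injective r h.choose_spec
  refine ⟨P, ?_, ?_⟩
  · intro b x hx
    by_cases h : ∃ a : T, Ordinal.typein r a = b
    · obtain ⟨a, rfl⟩ := h
      rw [hP] at hx
      have hxk := (rank_lt_of_mem hx).trans (val_lt a)
      refine ⟨Ordinal.typein r (mk x hxk), ?_, (hP _).trans (val_mk _ hxk)⟩
      rw [Ordinal.typein_lt_typein]
      apply r1
      rw [val_mk x hxk]
      exact rank_lt_of_mem hx
    · simp [P, dif_neg h] at hx
  · intro y hy
    exact ⟨_, hlt (mk y hy), (hP _).trans (val_mk _ hy)⟩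

/-- the pairing base -/
noncomputable def sq (b : Ordinal.{u}) : Ordinal.{u} :=
  ⨆ d : Set.Iio b, sq d.1 + (d.1 + 1)
termination_by b
decreasing_by exact d.2

theorem lt_add_iff' {x s a : Ordinal.{u}} : x < s + a ↔ x < s ∨ ∃ a' < a, x = s + a' := by
  constructor
  · intro h
    rcases lt_or_ge x s with h' | h'
    · exact Or.inl h'
    · right
      obtain ⟨y, rfl⟩ := exists_add_of_le h'
      exact ⟨y, by simpa using h, rfl⟩
  · rintro (h | ⟨a', h, rfl⟩)
    · exact h.trans_le (by simp)
    · simpa using h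

theorem lt_sq (b : Ordinal.{u}) : ∀ x, x < sq b ↔ ∃ d < b, ∃ a ≤ d, x = sq d + a := by
  induction b using WellFoundedLT.induction with
  | _ b ih =>
    intro x
    rw [sq, Ordinal.lt_iSup_iff]
    constructor
    · rintro ⟨⟨d, hd⟩, h⟩
      rcases lt_add_iff'.1 h with h | ⟨a, ha, rfl⟩
      · obtain ⟨e, he, a, ha, rfl⟩ := (ih d hd x).1 h
        exact ⟨e, he.trans hd, a, ha, rfl⟩
      · exact ⟨d, hd, a, Order.lt_add_one_iff.1 ha, rfl⟩
    · rintro ⟨d, hd, a, ha, rfl⟩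
      exact ⟨⟨d, hd⟩, by simpa using Order.lt_add_one_iff.2 ha⟩

theorem sq_le (b : Ordinal.{u}) : ∀ d ≤ b, sq d ≤ b * d := by
  intro d
  induction d using WellFoundedLT.induction with
  | _ d ih =>
    intro hd
    rw [sq]
    refine Ordinal.iSup_le ?_
    rintro ⟨e, he⟩
    have he : e < d := he
    calc sq e + (e + 1) ≤ b * e + b := add_le_add (ih e he (he.le.trans hd))
          ((Order.add_one_le_of_lt he).trans hd)
      _ = b * (e + 1) := by rw [mul_add, mul_one]
      _ ≤ b * d := mul_le_mul_right (Order.add_one_le_of_lt he) _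

/-- the pairing function -/
noncomputable def Q (a b : Ordinal.{u}) : Ordinal.{u} := sq b + a

theorem Q_lt {k : Ordinal.{u}} (hk : IC k) {a b} (hab : a ≤ b) (hb : b < k) : Q a b < k :=
  hk.add ((sq_le b b le_rfl).trans_lt (hk.mul hb hb)) (hab.trans_lt hb)

theorem lt_Q {a b : Ordinal.{u}} (hab : a ≤ b) (x) : x < Q a b ↔
    ∃ b' a', a' ≤ b' ∧ (b' < b ∨ b' = b ∧ a' < a) ∧ x = Q a' b' := by
  rw [Q, lt_add_iff', lt_sq]
  constructor
  · rintro (⟨d, hd, a, ha, rfl⟩ | ⟨a', h, rfl⟩)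
    · exact ⟨d, a, ha, Or.inl hd, rfl⟩
    · exact ⟨b, a', h.le.trans hab, Or.inr ⟨rfl, h⟩, rfl⟩
  · rintro ⟨b', a', h1, h2 | ⟨rfl, h2⟩, rfl⟩
    · exact Or.inl ⟨b', h2, a', h1, rfl⟩
    · exact Or.inr ⟨a', h2, rfl⟩

theorem Q_inj {a b a' b' : Ordinal.{u}} (hab : a ≤ b) (hab' : a' ≤ b') (h : Q a b = Q a' b') :
    a = a' ∧ b = b' := by
  have key : ∀ {a b a' b' : Ordinal.{u}}, a ≤ b → a' ≤ b' → Q a b = Q a' b' → ¬ b < b' := by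
    intro a b a' b' h1 h2 h3 h4
    have := (lt_Q h2 (Q a b)).2 ⟨b, a, h1, Or.inl h4, rfl⟩
    exact this.ne h3
  have e : b = b' := le_antisymm (not_lt.1 (key hab' hab h.symm)) (not_lt.1 (key hab hab' h))
  subst e
  refine ⟨?_, rfl⟩
  simpa [Q] using h

end WS

namespace WS
open ZFSet Order

theorem dfn_trip (i j k l) : Dfn.{u} Nice (fun _ v => pair (pair (v i) (v j)) (v k) ∈ v l) :=
  ((((dfn_pairEq (i + 1) (j + 1) 0).and (dfn_pairMem 0 (k + 1) (l + 1))).mono ntc).ex).congr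
    fun S hS v hv => by
      constructor
      · rintro ⟨x, -, h1, h2⟩
        have h1 : x = pair (v i) (v j) := h1
        subst h1
        exact h2
      · intro h
        exact ⟨_, hS.pr _ (hv i) _ (hv j), rfl, h⟩

theorem dfn_pm (i j k) : Dfn.{u} Nice (fun _ v => pair (v i) (v j) ∈ v k) :=
  (dfn_pairMem i j k).mono ntc

/-- the coding statement -/
structure Code (φ : SF) (S : Set ZFSet.{u}) (A k q p D g : ZFSet.{u}) : Prop where
  c1 : ∀ a ∈ k, ∀ b ∈ k, (a ∈ b ∨ a = b) → ∃ c ∈ k, pair (pair a b) c ∈ q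
  c2 : ∀ a ∈ k, ∀ b ∈ k, (a ∈ b ∨ a = b) → ∀ c ∈ k, pair (pair a b) c ∈ q →
    ∀ x ∈ k, (x ∈ c ↔ ∃ b' ∈ k, ∃ a' ∈ k, (a' ∈ b' ∨ a' = b') ∧ (b' ∈ b ∨ (b' = b ∧ a' ∈ a)) ∧
      pair (pair a' b') x ∈ q)
  c3 : ∀ b ∈ k, ∃ y ∈ S, pair b y ∈ p
  c4 : ∀ b ∈ k, ∀ y ∈ S, pair b y ∈ p → ∀ x ∈ S, (x ∈ y ↔ ∃ a ∈ b, ∃ c ∈ k,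
    pair (pair a b) c ∈ q ∧ c ∈ A ∧ pair a x ∈ p)
  c5 : ∀ y ∈ S, (ZOrd k ∧ rank y < rank k) → ∃ b ∈ k, pair b y ∈ p
  c6 : ∀ y ∈ S, (y ∈ D ↔ ∃ b ∈ k, ∃ c ∈ k, pair (pair b b) c ∈ q ∧ c ∈ A ∧ pair b y ∈ p)
  c7 : k ⊆ g
  c8 : ZOrd g ∧ (V_ (rank g)) ∈ S ∧ SatIn ∅ (Vclass (rank g)) φ (val2 D k)

theorem dfn_code (φ : SF) (hφ : φ.fv ⊆ {0, 1}) : Dfn.{u} Nice (fun S v =>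
    ∃ q ∈ S, ∃ p ∈ S, ∃ D ∈ S, ∃ g ∈ S, Code φ S (v 0) (v 1) q p D g) := by
  -- environment: 0 g, 1 D, 2 p, 3 q, 4 A, 5 k
  have h1 : Dfn.{u} Nice (fun _ v => ∀ a ∈ v 5, ∀ b ∈ v 5, (a ∈ b ∨ a = b) →
      ∃ c ∈ v 5, pair (pair a b) c ∈ v 3) :=
    ((((Dfn.mem 1 0).or (Dfn.eq 1 0)).imp ((dfn_trip 2 1 0 6).bex ntc 7)).ball ntc 6).ball ntc 5
  have h2 : Dfn.{u} Nice (fun _ v => ∀ a ∈ v 5, ∀ b ∈ v 5, (a ∈ b ∨ a = b) → ∀ c ∈ v 5,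
      pair (pair a b) c ∈ v 3 → ∀ x ∈ v 5, (x ∈ c ↔ ∃ b' ∈ v 5, ∃ a' ∈ v 5,
      (a' ∈ b' ∨ a' = b') ∧ (b' ∈ b ∨ (b' = b ∧ a' ∈ a)) ∧ pair (pair a' b') x ∈ v 3)) :=
    ((((Dfn.mem 1 0).or (Dfn.eq 1 0)).imp (((dfn_trip 2 1 0 6).imp (((Dfn.mem 0 1).iff
      (((((Dfn.mem 0 1).or (Dfn.eq 0 1)).and (((Dfn.mem 1 4).or ((Dfn.eq 1 4).and
        (Dfn.mem 0 5))).and (dfn_trip 0 1 2 9))).bex ntc 10).bex ntc 9)).ball ntc 8)).ball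
          ntc 7)).ball ntc 6).ball ntc 5
  have h3 : Dfn.{u} Nice (fun S v => ∀ b ∈ v 5, ∃ y ∈ S, pair b y ∈ v 2) :=
    (dfn_pm 1 0 4).ex.ball ntc 5
  have h4 : Dfn.{u} Nice (fun S v => ∀ b ∈ v 5, ∀ y ∈ S, pair b y ∈ v 2 → ∀ x ∈ S,
      (x ∈ y ↔ ∃ a ∈ b, ∃ c ∈ v 5, pair (pair a b) c ∈ v 3 ∧ c ∈ v 4 ∧ pair a x ∈ v 2)) :=
    (((dfn_pm 1 0 4).imp ((Dfn.mem 0 1).iff ((((dfn_trip 1 4 0 8).and ((Dfn.mem 0 9).and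
      (dfn_pm 1 2 7))).bex ntc 9).bex ntc 2)).all).all).ball ntc 5
  have h5 : Dfn.{u} Nice (fun S v => ∀ y ∈ S, (ZOrd (v 5) ∧ rank y < rank (v 5)) →
      ∃ b ∈ v 5, pair b y ∈ v 2) :=
    ((dfn_rank 0 6).imp ((dfn_pm 0 1 4).bex ntc 6)).all
  have h6 : Dfn.{u} Nice (fun S v => ∀ y ∈ S, (y ∈ v 1 ↔ ∃ b ∈ v 5, ∃ c ∈ v 5,
      pair (pair b b) c ∈ v 3 ∧ c ∈ v 4 ∧ pair b y ∈ v 2)) :=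
    ((Dfn.mem 0 2).iff ((((dfn_trip 1 1 0 6).and ((Dfn.mem 0 7).and (dfn_pm 1 2 5))).bex
      ntc 7).bex ntc 6)).all
  have h7 : Dfn.{u} Nice (fun _ v => v 5 ⊆ v 0) := (dfn_sub 5 0).mono ntc
  have h8 := dfn_VSat.{u} φ hφ 1 5 0
  have := (h1.and (h2.and (h3.and (h4.and (h5.and (h6.and (h7.and h8))))))).ex.ex.ex.ex
  refine this.congr fun S hS v hv => ?_
  refine exists_congr fun q => and_congr_right fun _ => exists_congr fun p =>
    and_congr_right fun _ => exists_congr fun D => and_congr_right fun _ => exists_congr fun g =>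
    and_congr_right fun _ => ?_
  exact ⟨fun ⟨a1, a2, a3, a4, a5, a6, a7, a8⟩ => ⟨a1, a2, a3, a4, a5, a6, a7, a8⟩,
    fun ⟨a1, a2, a3, a4, a5, a6, a7, a8⟩ => ⟨a1, a2, a3, a4, a5, a6, a7, a8⟩⟩

theorem ball_ord {o : Ordinal.{u}} {p : ZFSet.{u} → Prop} :
    (∀ a ∈ o.toZFSet, p a) ↔ ∀ a < o, p a.toZFSet := by
  constructor
  · intro h a ha
    exact h _ (Ordinal.toZFSet_mem_toZFSet_iff.2 ha)
  · intro h a ha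
    obtain ⟨b, hb, rfl⟩ := Ordinal.mem_toZFSet_iff.1 ha
    exact h b hb

theorem bex_ord {o : Ordinal.{u}} {p : ZFSet.{u} → Prop} :
    (∃ a ∈ o.toZFSet, p a) ↔ ∃ a < o, p a.toZFSet := by
  constructor
  · rintro ⟨a, ha, h⟩
    obtain ⟨b, hb, rfl⟩ := Ordinal.mem_toZFSet_iff.1 ha
    exact ⟨b, hb, h⟩
  · rintro ⟨a, ha, h⟩
    exact ⟨_, Ordinal.toZFSet_mem_toZFSet_iff.2 ha, h⟩

theorem ord_inj {a b : Ordinal.{u}} : a.toZFSet = b.toZFSet ↔ a = b :=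
  Ordinal.toZFSet_injective.eq_iff

theorem le_iff_mem {a b : Ordinal.{u}} :
    (a.toZFSet ∈ b.toZFSet ∨ a.toZFSet = b.toZFSet) ↔ a ≤ b := by
  rw [ord_inj, Ordinal.toZFSet_mem_toZFSet_iff, le_iff_lt_or_eq]

/-- the set coding `A` and the membership relation -/
noncomputable def codeSet (k : Ordinal.{u}) (P : Ordinal.{u} → ZFSet.{u}) (A : ZFSet.{u}) :
    ZFSet.{u} :=
  ZFSet.sep (fun c => ∃ a b : Ordinal.{u}, a ≤ b ∧ c = (Q a b).toZFSet ∧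
    ((a < b ∧ P a ∈ P b) ∨ (a = b ∧ P b ∈ A))) k.toZFSet

theorem mem_codeSet {k : Ordinal.{u}} {P : Ordinal.{u} → ZFSet.{u}} {A : ZFSet.{u}} {a b}
    (hab : a ≤ b) : (Q a b).toZFSet ∈ codeSet k P A ↔ Q a b < k ∧
      ((a < b ∧ P a ∈ P b) ∨ (a = b ∧ P b ∈ A)) := by
  rw [codeSet, mem_sep, Ordinal.toZFSet_mem_toZFSet_iff]
  refine and_congr_right fun _ => ⟨?_, fun h => ⟨a, b, hab, rfl, h⟩⟩
  rintro ⟨a', b', h1, h2, h3⟩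
  obtain ⟨rfl, rfl⟩ := Q_inj hab h1 (ord_inj.1 h2)
  exact h3

theorem rank_P {P : Ordinal.{u} → ZFSet.{u}} (hP : ∀ b, ∀ x ∈ P b, ∃ a < b, P a = x) :
    ∀ b, rank (P b) ≤ b := by
  intro b
  induction b using WellFoundedLT.induction with
  | _ b ih =>
    rw [rank_le_iff]
    intro x hx
    obtain ⟨a, ha, rfl⟩ := hP b x hx
    exact (ih a ha).trans_lt ha

/-- the coding statement holds in `V_θ` -/
theorem code_up {k : Ordinal.{u}} (hk : IC k) {P : Ordinal.{u} → ZFSet.{u}}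
    (hP : ∀ b, ∀ x ∈ P b, ∃ a < b, P a = x) (hP' : ∀ y, rank y < k → ∃ b < k, P b = y)
    {A : ZFSet.{u}} (hA : ∀ y ∈ A, rank y < k) (φ : SF) {γ θ : Ordinal.{u}} (hkγ : k ≤ γ)
    (hγ : γ < θ) (hθ : Big θ) (hsat : SatIn ∅ (Vclass γ) φ (val2 A k.toZFSet)) :
    ∃ q ∈ Vclass θ, ∃ p ∈ Vclass θ, ∃ D ∈ Vclass θ, ∃ g ∈ Vclass θ,
      Code φ (Vclass θ) (codeSet k P A) k.toZFSet q p D g := by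
  have hkθ : k < θ := hkγ.trans_lt hγ
  let X : ZFSet.{u} := V_ (succ (succ (succ (succ (succ k)))))
  have hX : ∀ f : ZFSet.{u} → Prop, ZFSet.sep f X ∈ Vclass θ := by
    intro f
    refine lt_of_le_of_lt (rank_mono (sep_subset)) ?_
    rw [rank_vonNeumann]
    exact hθ.succ (hθ.succ (hθ.succ (hθ.succ (hθ.succ hkθ))))
  let q : ZFSet.{u} := ZFSet.sep (fun z => ∃ a b : Ordinal.{u},
    z = pair (pair a.toZFSet b.toZFSet) (Q a b).toZFSet) X
  let p : ZFSet.{u} := ZFSet.sep (fun z => ∃ a : Ordinal.{u}, z = pair a.toZFSet (P a)) X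
  have hq : ∀ a b c : Ordinal.{u}, a < k → b < k → c < k →
      (pair (pair a.toZFSet b.toZFSet) c.toZFSet ∈ q ↔ c = Q a b) := by
    intro a b c ha hb hc
    rw [mem_sep, mem_vonNeumann]
    constructor
    · rintro ⟨-, a', b', e⟩
      obtain ⟨e1, e2⟩ := pair_inj.1 e
      obtain ⟨e3, e4⟩ := pair_inj.1 e1
      rw [ord_inj] at e2 e3 e4
      subst e3 e4
      exact e2
    · rintro rfl
      refine ⟨lt_succ_of_le (rank_opair_lt (rank_opair_lt ?_ ?_) ?_), a, b, rfl⟩ <;>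
        rw [Ordinal.rank_toZFSet]
      · exact ha.le
      · exact hb.le
      · exact hc.le.trans ((le_succ _).trans (le_succ _))
  have hp : ∀ a : Ordinal.{u}, a < k → ∀ y, (pair a.toZFSet y ∈ p ↔ y = P a) := by
    intro a ha y
    rw [mem_sep, mem_vonNeumann]
    constructor
    · rintro ⟨-, a', e⟩
      obtain ⟨e1, e2⟩ := pair_inj.1 e
      rw [ord_inj] at e1
      subst e1
      exact e2
    · rintro rfl
      refine ⟨lt_succ_of_le ((rank_opair_lt (o := k) ?_ ?_).trans
        ((le_succ _).trans (le_succ _))), a, rfl⟩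
      · rw [Ordinal.rank_toZFSet]; exact ha.le
      · exact (rank_P hP a).trans ha.le
  refine ⟨q, hX _, p, hX _, A, ?_, γ.toZFSet, ?_, ?_⟩
  · exact (rank_le_iff.2 hA).trans_lt hkθ
  · show rank _ < θ
    rwa [Ordinal.rank_toZFSet]
  constructor
  · simp only [ball_ord, bex_ord, le_iff_mem]
    intro a ha b hb hab
    exact ⟨Q a b, Q_lt hk hab hb, (hq _ _ _ ha hb (Q_lt hk hab hb)).2 rfl⟩
  · simp only [ball_ord, bex_ord, le_iff_mem]
    intro a ha b hb hab c hc h1 x hx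
    rw [hq _ _ _ ha hb hc] at h1
    subst h1
    rw [Ordinal.toZFSet_mem_toZFSet_iff, lt_Q hab]
    constructor
    · rintro ⟨b', a', h1, h2, h3⟩
      have hb' : b' < k := by
        rcases h2 with h | h
        · exact h.trans hb
        · exact h.1 ▸ hb
      refine ⟨b', hb', a', h1.trans_lt hb', h1, ?_, (hq _ _ _ (h1.trans_lt hb') hb' hx).2 h3⟩
      simpa only [Ordinal.toZFSet_mem_toZFSet_iff, ord_inj] using h2
    · rintro ⟨b', hb', a', ha', h1, h2, h3⟩
      refine ⟨b', a', h1, ?_, (hq _ _ _ ha' hb' hx).1 h3⟩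
      simpa only [Ordinal.toZFSet_mem_toZFSet_iff, ord_inj] using h2
  · simp only [ball_ord]
    intro b hb
    refine ⟨P b, ?_, (hp b hb _).2 rfl⟩
    exact (rank_P hP b).trans_lt (hb.trans hkθ)
  · simp only [ball_ord, bex_ord]
    intro b hb y _ hy x _
    rw [hp b hb] at hy
    subst hy
    constructor
    · intro hx
      obtain ⟨a, ha, rfl⟩ := hP b x hx
      have hQ := Q_lt hk ha.le hb
      exact ⟨a, ha, Q a b, hQ, (hq _ _ _ (ha.trans hb) hb hQ).2 rfl,
        (mem_codeSet ha.le).2 ⟨hQ, Or.inl ⟨ha, hx⟩⟩, (hp a (ha.trans hb) _).2 rfl⟩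
    · rintro ⟨a, ha, c, hc, h1, h2, h3⟩
      rw [hq _ _ _ (ha.trans hb) hb hc] at h1
      subst h1
      rw [hp a (ha.trans hb)] at h3
      subst h3
      rcases ((mem_codeSet ha.le).1 h2).2 with h | h
      · exact h.2
      · exact absurd h.1 ha.ne
  · simp only [bex_ord]
    rintro y - ⟨-, hy⟩
    rw [Ordinal.rank_toZFSet] at hy
    obtain ⟨b, hb, rfl⟩ := hP' y hy
    exact ⟨b, hb, (hp b hb _).2 rfl⟩
  · simp only [bex_ord]
    intro y _
    constructor
    · intro hy
      obtain ⟨b, hb, rfl⟩ := hP' y (hA y hy)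
      have hQ := Q_lt hk le_rfl hb
      exact ⟨b, hb, Q b b, hQ, (hq _ _ _ hb hb hQ).2 rfl,
        (mem_codeSet le_rfl).2 ⟨hQ, Or.inr ⟨rfl, hy⟩⟩, (hp b hb _).2 rfl⟩
    · rintro ⟨b, hb, c, hc, h1, h2, h3⟩
      rw [hq _ _ _ hb hb hc] at h1
      subst h1
      rw [hp b hb] at h3
      subst h3
      rcases ((mem_codeSet le_rfl).1 h2).2 with h | h
      · exact absurd h.1 (lt_irrefl _)
      · exact h.2
  · exact Ordinal.toZFSet_subset_toZFSet_iff.2 hkγ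
  · rw [Ordinal.rank_toZFSet]
    refine ⟨zord_toZFSet γ, ?_, hsat⟩
    show rank _ < θ
    rwa [rank_vonNeumann]

/-- the coding statement reflected to a smaller cardinal -/
theorem code_down {k m : Ordinal.{u}} {P : Ordinal.{u} → ZFSet.{u}}
    (hP : ∀ b, ∀ x ∈ P b, ∃ a < b, P a = x)
    {A : ZFSet.{u}} (φ : SF) (hmk : m < k) {S : Set ZFSet.{u}}
    (hS : Nice S) {q p D g : ZFSet.{u}} (hp : p ∈ S) (hD : D ∈ S)
    (h : Code φ S (codeSet k P A ∩ m.toZFSet) m.toZFSet q p D g) :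
    ∃ γ, m ≤ γ ∧ SatIn ∅ (Vclass γ) φ (val2 (Vres A m.toZFSet) m.toZFSet) := by
  have c1 := h.c1
  have c2 := h.c2
  have c3 := h.c3
  have c4 := h.c4
  have c5 := h.c5
  have c6 := h.c6
  simp only [ball_ord, bex_ord, le_iff_mem] at c1 c2 c3 c4 c5 c6
  have hq : ∀ b < m, ∀ a ≤ b, ∀ c < m,
      pair (pair a.toZFSet b.toZFSet) c.toZFSet ∈ q → c = Q a b := by
    intro b
    induction b using WellFoundedLT.induction with
    | _ b ihb =>
      intro hb a
      induction a using WellFoundedLT.induction with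
      | _ a iha =>
        intro hab c hc hqc
        have ih : ∀ b' a', a' ≤ b' → (b' < b ∨ b' = b ∧ a' < a) → ∀ c < m,
            pair (pair a'.toZFSet b'.toZFSet) c.toZFSet ∈ q → c = Q a' b' := by
          rintro b' a' h1 (h2 | ⟨rfl, h2⟩)
          · exact ihb b' h2 (h2.trans hb) a' h1
          · exact iha a' h2 h1
        have key := c2 a (hab.trans_lt hb) b hb hab c hc hqc
        simp only [Ordinal.toZFSet_mem_toZFSet_iff, ord_inj] at key
        apply eq_of_forall_lt_iff
        intro x
        rw [lt_Q hab]
        constructor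
        · intro hx
          obtain ⟨b', hb', a', ha', h1, h2, h3⟩ := (key x (hx.trans hc)).1 hx
          exact ⟨b', a', h1, h2, ih b' a' h1 h2 x (hx.trans hc) h3⟩
        · rintro ⟨b', a', h1, h2, h3⟩
          have hb' : b' < m := by
            rcases h2 with h | h
            · exact h.trans hb
            · exact h.1 ▸ hb
          obtain ⟨c', hc', h4⟩ := c1 a' (h1.trans_lt hb') b' hb' h1
          have := ih b' a' h1 h2 c' hc' h4
          rw [← this] at h3
          subst h3
          exact (key x hc').2 ⟨b', hb', a', h1.trans_lt hb', h1, h2, h4⟩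
  have hq' : ∀ b < m, ∀ a ≤ b, Q a b < m ∧
      pair (pair a.toZFSet b.toZFSet) (Q a b).toZFSet ∈ q := by
    intro b hb a hab
    obtain ⟨c, hc, h1⟩ := c1 a (hab.trans_lt hb) b hb hab
    have := hq b hb a hab c hc h1
    subst this
    exact ⟨hc, h1⟩
  have hcode : ∀ a b, a ≤ b → Q a b < m → ((Q a b).toZFSet ∈ codeSet k P A ∩ m.toZFSet ↔
      ((a < b ∧ P a ∈ P b) ∨ (a = b ∧ P b ∈ A))) := by
    intro a b hab hQ
    rw [mem_inter, mem_codeSet hab, Ordinal.toZFSet_mem_toZFSet_iff]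
    have := hQ.trans hmk
    tauto
  have hp1 : ∀ b < m, ∀ y ∈ S, pair b.toZFSet y ∈ p → y = P b := by
    intro b
    induction b using WellFoundedLT.induction with
    | _ b ih =>
      intro hb y hy hby
      have key := c4 b hb y hy hby
      ext x
      constructor
      · intro hx
        have hxS := hS.tc.1 y hy x hx
        obtain ⟨a, ha, c, hc, h1, h2, h3⟩ := (key x hxS).1 hx
        have e := hq b hb a ha.le c hc h1
        subst e
        have e := ih a ha (ha.trans hb) x hxS h3
        subst e
        rcases (hcode a b ha.le hc).1 h2 with h | h
        · exact h.2
        · exact absurd h.1 ha.ne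
      · intro hx
        obtain ⟨a, ha, rfl⟩ := hP b x hx
        obtain ⟨y', hy', h1⟩ := c3 a (ha.trans hb)
        have e := ih a ha (ha.trans hb) y' hy' h1
        subst e
        obtain ⟨h2, h3⟩ := hq' b hb a ha.le
        exact (key _ hy').2 ⟨a, ha, _, h2, h3, (hcode a b ha.le h2).2 (Or.inl ⟨ha, hx⟩), h1⟩
  have hp2 : ∀ b < m, P b ∈ S ∧ pair b.toZFSet (P b) ∈ p := by
    intro b hb
    obtain ⟨y, hy, h1⟩ := c3 b hb
    have e := hp1 b hb y hy h1
    subst e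
    exact ⟨hy, h1⟩
  obtain ⟨t, htS, ht, hpt⟩ := hS.trc p hp
  have hPt : ∀ b < m, P b ∈ t := by
    intro b hb
    have h1 := ht _ hpt (hp2 b hb).2
    have h2 : ({b.toZFSet, P b} : ZFSet) ∈ t := ht _ h1 (by simp [pair])
    exact ht _ h2 (by simp)
  have hsurj : ∀ y : ZFSet.{u}, rank y < m → ∃ b < m, P b = y := by
    intro y
    induction y using ZFSet.inductionOn with
    | _ y ih =>
      intro hy
      have hyS : y ∈ S := by
        refine hS.tc.2 t htS y fun x hx => ?_
        obtain ⟨b, hb, rfl⟩ := ih x hx ((rank_lt_of_mem hx).trans hy)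
        exact hPt b hb
      obtain ⟨b, hb, h1⟩ := c5 y hyS ⟨zord_toZFSet m, by rwa [Ordinal.rank_toZFSet]⟩
      exact ⟨b, hb, (hp1 b hb y hyS h1).symm⟩
  have hDA : D = Vres A m.toZFSet := by
    ext y
    rw [Vres, mem_sep, Ordinal.rank_toZFSet]
    constructor
    · intro hy
      have hyS := hS.tc.1 D hD y hy
      obtain ⟨b, hb, c, hc, h1, h2, h3⟩ := (c6 y hyS).1 hy
      have e := hq b hb b le_rfl c hc h1
      subst e
      have e := hp1 b hb y hyS h3
      subst e
      refine ⟨?_, (rank_P hP b).trans_lt hb⟩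
      rcases (hcode b b le_rfl hc).1 h2 with h | h
      · exact absurd h.1 (lt_irrefl _)
      · exact h.2
    · rintro ⟨hy, hym⟩
      obtain ⟨b, hb, rfl⟩ := hsurj y hym
      obtain ⟨h1, h2⟩ := hq' b hb b le_rfl
      exact (c6 _ (hp2 b hb).1).2 ⟨b, hb, _, h1, h2,
        (hcode b b le_rfl h1).2 (Or.inr ⟨rfl, hy⟩), (hp2 b hb).2⟩
  subst hDA
  refine ⟨rank g, ?_, h.c8.2.2⟩
  have := rank_mono h.c7
  rwa [Ordinal.rank_toZFSet] at this

end WS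

namespace WS
open ZFSet Order

theorem ic_of_infCard {κ : ZFSet.{u}} (h : InfCard κ) : IC (rank κ) := by
  have e := zord_rank h.1.1
  refine ⟨?_, ?_⟩
  · rw [Ordinal.omega0_le]
    intro n
    have hn : ∀ n : ℕ, ∃ x ∈ κ, (n : Ordinal.{u}) ≤ rank x := by
      intro n
      induction n with
      | zero => exact ⟨_, h.2 omega_zero, by simp⟩
      | succ n _ =>
        have : ∀ n : ℕ, ∃ x ∈ (omega : ZFSet.{u}), (n : Ordinal.{u}) ≤ rank x := by
          intro n
          induction n with
          | zero => exact ⟨_, omega_zero, by simp⟩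
          | succ n ih =>
            obtain ⟨x, hx, hnx⟩ := ih
            refine ⟨_, omega_succ hx, ?_⟩
            rw [rank_insert]
            refine le_max_of_le_left ?_
            push_cast
            rw [Order.succ_eq_add_one]
            gcongr
        obtain ⟨x, hx, hnx⟩ := this (n + 1)
        exact ⟨x, h.2 hx, hnx⟩
    obtain ⟨x, hx, hnx⟩ := hn n
    exact hnx.trans (rank_lt_of_mem hx).le
  · rw [← zcard_iff, e]
    exact h.1

theorem least_definable {k m γ1 : Ordinal.{u}} (hk : IC k) (hV : ∀ γ < k, card (V_ γ) < k.card)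
    (hm : m < k) {φ : SF} (hφ : φ.fv ⊆ {0, 1}) {a : ZFSet.{u}} (ha : rank a ≤ m) (hγ : m ≤ γ1)
    (hsat : SatIn ∅ (Vclass γ1) φ (val2 a m.toZFSet))
    (hleast : ∀ γ, m ≤ γ → SatIn ∅ (Vclass γ) φ (val2 a m.toZFSet) → γ1 ≤ γ)
    (hkγ : k ≤ γ1) : RHS k.toZFSet := by
  let VS : Set ZFSet.{u} → ZFSet.{u} → ZFSet.{u} → ZFSet.{u} → Prop := fun S a b g =>
    ZOrd g ∧ (V_ (rank g)) ∈ S ∧ SatIn ∅ (Vclass (rank g)) φ (val2 a b)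
  have hVS : ∀ a b g, Dfn.{u} Nice (fun S v => VS S (v a) (v b) (v g)) := fun a b g =>
    dfn_VSat φ hφ a b g
  have hR : Dfn.{u} Nice (fun S v => ∃ a ∈ S, ∃ b ∈ S, v 1 = pair a b ∧ b ⊆ v 0 ∧ VS S a b (v 0) ∧
      ∀ w' ∈ v 0, b ⊆ w' → ¬ VS S a b w') :=
    (((dfn_pairEq 1 0 3).mono ntc).and (((dfn_sub 0 2).mono ntc).and ((hVS 1 0 2).and
      ((((dfn_sub 1 0).mono ntc).imp (hVS 2 1 0).not).ball ntc 2)))).ex.ex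
  refine lemmaD (z := pair a m.toZFSet) (w0 := γ1.toZFSet) hR ?_ ?_ γ1 ?_ ?_
  · apply hset_of_rank hV
    refine (rank_opair_lt ha ?_).trans_lt (hk.succ (hk.succ hm))
    rw [Ordinal.rank_toZFSet]
  · rintro S w hS hw - ⟨a', ha', b, hb, h1, h2, h3, h4⟩
    obtain ⟨rfl, rfl⟩ := pair_inj.1 h1
    have h2 : m.toZFSet ⊆ w := h2
    obtain ⟨o1, o2, o3⟩ : VS S a m.toZFSet w := h3
    have h4 : ∀ w' ∈ w, m.toZFSet ⊆ w' → ¬ VS S a m.toZFSet w' := h4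
    have e := zord_rank o1
    have hle : γ1 ≤ rank w := by
      refine hleast _ ?_ o3
      have := rank_mono h2
      rwa [Ordinal.rank_toZFSet] at this
    rcases hle.eq_or_lt with h | h
    · rw [h, e]
    · exfalso
      refine h4 γ1.toZFSet ?_ (Ordinal.toZFSet_subset_toZFSet_iff.2 hγ) ⟨zord_toZFSet _, ?_, ?_⟩
      · rw [← e]
        exact Ordinal.toZFSet_mem_toZFSet_iff.2 h
      · rw [Ordinal.rank_toZFSet]
        exact hS.tc.1 _ o2 _ (vonNeumann_mem_of_lt h)
      · rw [Ordinal.rank_toZFSet]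
        exact hsat
  · intro β hβ hB
    have hmβ : m < β := hγ.trans_lt hβ
    refine ⟨a, ha.trans_lt hmβ, m.toZFSet, ?_, rfl, ?_, ⟨zord_toZFSet _, ?_, ?_⟩, ?_⟩
    · show rank _ < β
      rwa [Ordinal.rank_toZFSet]
    · exact Ordinal.toZFSet_subset_toZFSet_iff.2 hγ
    · show rank (V_ (rank γ1.toZFSet)) < β
      rwa [rank_vonNeumann, Ordinal.rank_toZFSet]
    · show SatIn ∅ (Vclass (rank γ1.toZFSet)) _ _
      rw [Ordinal.rank_toZFSet]
      exact hsat
    · show ∀ w' ∈ γ1.toZFSet, m.toZFSet ⊆ w' → ¬ VS _ _ _ w'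
      rw [ball_ord]
      rintro γ hγ1 hm1 ⟨-, -, h⟩
      rw [Ordinal.rank_toZFSet] at h
      exact (hleast γ (Ordinal.toZFSet_subset_toZFSet_iff.1 hm1) h).not_gt hγ1
  · rw [Ordinal.card_toZFSet]
    exact Ordinal.card_le_card hkγ

theorem forward {κ : ZFSet.{u}} (h : WeaklyShrewd κ) (hn : ¬ RHS κ) : Shrewd κ := by
  have hk := ic_of_infCard h.1
  have eκ := zord_rank h.1.1.1
  refine ⟨h.1.1, ?_⟩
  intro φ α A hφ hα hA hsat
  generalize hkk : rank κ = k at *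
  subst eκ
  have hV := small_V hk.lt hn
  obtain ⟨P, hP, hP'⟩ := exists_pi hk hV
  obtain ⟨θ, hθ, hB⟩ := exists_big (k + rank α)
  obtain ⟨ψ, p1, p2⟩ := (dfn_code φ hφ).nice.formula
  have hkθ : k < θ := lt_of_le_of_lt (by simp) hθ
  have hkey := h.2 ψ θ.toZFSet (codeSet k P A) p1 hB.zcard
    (Ordinal.toZFSet_mem_toZFSet_iff.2 hkθ) sep_subset (by
      rw [hB.hset, p2 _ (tc_V θ)]
      refine ⟨?_, ?_, hB.nice, ?_⟩
      · refine (rank_mono sep_subset).trans_lt ?_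
        rwa [Ordinal.rank_toZFSet]
      · show rank _ < θ
        rwa [Ordinal.rank_toZFSet]
      · exact code_up hk hP hP' hA φ (by simp) hθ hB hsat)
  obtain ⟨κ', θ', z1, z2, z3, z4, hs⟩ := hkey
  obtain ⟨m, hm, rfl⟩ := Ordinal.mem_toZFSet_iff.1 z4
  rw [p2 _ (tc_H θ')] at hs
  obtain ⟨-, -, hS, q, -, p, hp, D, hD, g, -, hc⟩ := hs
  have hex := code_down hP φ hm hS hp hD hc
  obtain ⟨γ1, ⟨g1, g2⟩, g3⟩ := WellFounded.has_min (wellFounded_lt (α := Ordinal.{u}))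
    {γ | m ≤ γ ∧ SatIn ∅ (Vclass γ) φ (val2 (Vres A m.toZFSet) m.toZFSet)} hex
  have hγ1 : γ1 < k := by
    by_contra hc
    refine hn (least_definable hk hV hm hφ (a := Vres A m.toZFSet) ?_ g1 g2
      (fun γ h1 h2 => not_lt.1 (g3 γ ⟨h1, h2⟩)) (not_lt.1 hc))
    rw [rank_le_iff]
    intro y hy
    have := (mem_sep.1 hy).2
    rwa [Ordinal.rank_toZFSet] at this
  refine ⟨m.toZFSet, (γ1 - m).toZFSet, z4, Ordinal.toZFSet_mem_toZFSet_iff.2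
    ((Ordinal.sub_le_self _ _).trans_lt hγ1), ?_⟩
  rw [Ordinal.rank_toZFSet, Ordinal.rank_toZFSet, Ordinal.add_sub_cancel_of_le g1]
  exact g2

end WS

/-! ### Skolem hulls, collapses and correctness -/

namespace WS
open ZFSet Order

/-- an injective coding of formulas -/
def enc : SF → ℕ
  | .mem i j => Nat.pair 0 (Nat.pair i j)
  | .eq i j => Nat.pair 1 (Nat.pair i j)
  | .pred i => Nat.pair 2 i
  | .not φ => Nat.pair 3 (enc φ)
  | .and φ ψ => Nat.pair 4 (Nat.pair (enc φ) (enc ψ))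
  | .ex k φ => Nat.pair 5 (Nat.pair k (enc φ))

theorem enc_inj : ∀ φ ψ : SF, enc φ = enc ψ → φ = ψ := by
  intro φ
  induction φ with
  | mem i j => intro ψ h; cases ψ <;> simp [enc, Nat.pair_eq_pair] at h ⊢; exact h
  | eq i j => intro ψ h; cases ψ <;> simp [enc, Nat.pair_eq_pair] at h ⊢; exact h
  | pred i => intro ψ h; cases ψ <;> simp [enc, Nat.pair_eq_pair] at h ⊢; exact h
  | not φ ih => intro ψ h; cases ψ <;> simp [enc, Nat.pair_eq_pair] at h ⊢; exact ih _ h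
  | and φ χ ih1 ih2 =>
    intro ψ h
    cases ψ <;> simp [enc, Nat.pair_eq_pair] at h ⊢
    exact ⟨ih1 _ h.1, ih2 _ h.2⟩
  | ex k φ ih =>
    intro ψ h
    cases ψ <;> simp [enc, Nat.pair_eq_pair] at h ⊢
    exact ⟨h.1, ih _ h.2⟩

theorem countable_SF : Countable SF := ⟨⟨enc, fun a b h => enc_inj a b h⟩⟩

theorem fv_bdd (φ : SF) : ∃ n, ∀ i ∈ φ.fv, i < n := by
  have : φ.fv.Finite := by
    induction φ with
    | mem i j => exact Set.toFinite {i, j}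
    | eq i j => exact Set.toFinite {i, j}
    | pred i => exact Set.toFinite {i}
    | not φ ih => exact ih
    | and φ ψ ih1 ih2 => exact ih1.union ih2
    | ex k φ ih => exact ih.subset Set.sdiff_subset
  obtain ⟨n, hn⟩ := this.bddAbove
  exact ⟨n + 1, fun i hi => Nat.lt_succ_of_le (hn hi)⟩

/-- the language of Skolem functions -/
def skL : FirstOrder.Language.{0, 0} := ⟨fun _ => SF × ℕ, fun _ => Empty⟩

/-- valuation from a finite tuple -/
def fval {n : ℕ} (a : Fin n → ZFSet.{u}) : ℕ → ZFSet.{u} :=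
  fun i => if h : i < n then a ⟨i, h⟩ else ∅

open Classical in
/-- Skolem functions -/
noncomputable def sk (φ : SF) (k : ℕ) (v : ℕ → ZFSet.{u}) : ZFSet.{u} :=
  if h : ∃ x, SatIn ∅ Set.univ φ (Function.update v k x) then h.choose else ∅

theorem sk_spec (φ : SF) (k : ℕ) (v : ℕ → ZFSet.{u})
    (h : ∃ x, SatIn ∅ Set.univ φ (Function.update v k x)) :
    SatIn ∅ Set.univ φ (Function.update v k (sk φ k v)) := by
  unfold sk
  rw [dif_pos h]
  exact h.choose_spec

noncomputable instance skStr : skL.Structure ZFSet.{u} where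
  funMap := fun {_} f a => sk f.1 f.2 (fval a)
  RelMap := fun {_} r => nomatch r

theorem exists_hull (t : ZFSet.{u}) (ht : ℵ₀ ≤ card t) : ∃ N : Set ZFSet.{u},
    (∀ x ∈ t, x ∈ N) ∧ #N ≤ lift.{u + 1} (card t) ∧
    ∀ φ (v : ℕ → ZFSet.{u}), (∀ i, v i ∈ N) → (SatIn ∅ N φ v ↔ SatIn ∅ Set.univ φ v) := by
  let C : skL.Substructure ZFSet.{u} := FirstOrder.Language.Substructure.closure skL {x | x ∈ t}
  refine ⟨C, ?_, ?_, ?_⟩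
  · intro x hx
    exact FirstOrder.Language.Substructure.subset_closure hx
  · have h := @FirstOrder.Language.Substructure.lift_card_closure_le skL ZFSet.{u} _ {x | x ∈ t}
    have h1 : #{x | x ∈ t} = lift.{u + 1} (card t) := cardinalMk_coe_sort
    have h2 : #((i : ℕ) × skL.Functions i) ≤ ℵ₀ := by
      have := countable_SF
      have : ∀ i, Countable (skL.Functions i) := fun i => inferInstanceAs (Countable (SF × ℕ))
      exact mk_le_aleph0
    rw [h1] at h
    have h3 : lift.{0} #C ≤ lift.{u+1} (card t) := by
      refine h.trans (max_le ?_ ?_)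
      · rw [aleph0_le_lift]; exact ht
      · have h4 : ℵ₀ ≤ lift.{u+1} (card t) := by rw [aleph0_le_lift]; exact ht
        rw [lift_uzero]
        refine (add_le_add_right (?_ : _ ≤ lift.{u+1} (card t)) _).trans (add_eq_self h4).le
        refine (lift_le.2 h2).trans ?_
        rwa [lift_aleph0]
    rwa [lift_uzero] at h3
  · intro φ
    induction φ with
    | mem i j => intro v _; exact Iff.rfl
    | eq i j => intro v _; exact Iff.rfl
    | pred i => intro v _; exact Iff.rfl
    | not φ ih => intro v hv; exact not_congr (ih v hv)
    | and φ ψ ih1 ih2 => intro v hv; exact and_congr (ih1 v hv) (ih2 v hv)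
    | ex k φ ih =>
      intro v hv
      have hu : ∀ x ∈ (C : Set ZFSet.{u}), ∀ i, Function.update v k x i ∈ (C : Set ZFSet.{u}) := by
        intro x hx i
        by_cases hi : i = k
        · subst hi; simpa using hx
        · rw [Function.update_of_ne hi]; exact hv i
      constructor
      · rintro ⟨x, hx, h⟩
        exact ⟨x, trivial, (ih _ (hu x hx)).1 h⟩
      · rintro ⟨x, -, h⟩
        obtain ⟨n, hn⟩ := fv_bdd φ
        let a : Fin n → ZFSet.{u} := fun i => v i
        have hc : ∀ y, SatIn ∅ Set.univ φ (Function.update v k y) ↔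
            SatIn ∅ Set.univ φ (Function.update (fval a) k y) := by
          intro y
          refine sat_congr _ _ _ _ fun i hi => ?_
          by_cases hik : i = k
          · subst hik; simp
          · rw [Function.update_of_ne hik, Function.update_of_ne hik]
            simp [fval, hn i hi, a]
        have hs := sk_spec φ k (fval a) ⟨x, (hc x).1 h⟩
        have hm : sk φ k (fval a) ∈ (C : Set ZFSet.{u}) :=
          C.fun_mem (n := n) ((φ, k) : SF × ℕ) a (fun i => hv i)
        exact ⟨_, hm, (ih _ (hu _ hm)).2 ((hc _).2 hs)⟩

/-- Mostowski collapse -/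
noncomputable def clp (N : Set ZFSet.{u}) (x : ZFSet.{u}) : ZFSet.{u} :=
  range (fun y : (ZFSet.sep (fun y => y ∈ N) x : ZFSet.{u}) => clp N y.1)
termination_by x
decreasing_by exact (mem_sep.1 y.2).1

theorem mem_clp (N : Set ZFSet.{u}) (x z : ZFSet.{u}) :
    z ∈ clp N x ↔ ∃ y ∈ x, y ∈ N ∧ clp N y = z := by
  rw [clp, mem_range]
  constructor
  · rintro ⟨⟨y, hy⟩, rfl⟩
    exact ⟨y, (mem_sep.1 hy).1, (mem_sep.1 hy).2, rfl⟩
  · rintro ⟨y, h1, h2, rfl⟩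
    exact ⟨⟨y, mem_sep.2 ⟨h1, h2⟩⟩, rfl⟩

theorem clp_id {N : Set ZFSet.{u}} {t : ZFSet.{u}} (ht : t.IsTransitive) (hN : ∀ x ∈ t, x ∈ N) :
    ∀ x ∈ t, clp N x = x := by
  intro x
  induction x using ZFSet.inductionOn with
  | h x ih =>
    intro hx
    ext z
    rw [mem_clp]
    constructor
    · rintro ⟨y, h1, -, rfl⟩
      rwa [ih y h1 (ht x hx h1)]
    · intro hz
      exact ⟨z, hz, hN z (ht x hx hz), ih z hz (ht x hx hz)⟩

theorem clp_inj {N : Set ZFSet.{u}}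
    (hN : ∀ x ∈ N, ∀ y ∈ N, (∀ z ∈ N, z ∈ x ↔ z ∈ y) → x = y) :
    ∀ x ∈ N, ∀ y ∈ N, clp N x = clp N y → x = y := by
  intro x
  induction x using ZFSet.inductionOn with
  | h x ih =>
    intro hx y hy e
    refine hN x hx y hy fun z hz => ⟨fun h => ?_, fun h => ?_⟩
    · have := (mem_clp N x _).2 ⟨z, h, hz, rfl⟩
      rw [e, mem_clp] at this
      obtain ⟨z', h1, h2, h3⟩ := this
      rwa [ih z h hz z' h2 h3.symm]
    · have := (mem_clp N y _).2 ⟨z, h, hz, rfl⟩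
      rw [← e, mem_clp] at this
      obtain ⟨z', h1, h2, h3⟩ := this
      rwa [← ih z' h1 h2 z hz h3]

theorem clp_sat {N : Set ZFSet.{u}}
    (hN : ∀ x ∈ N, ∀ y ∈ N, (∀ z ∈ N, z ∈ x ↔ z ∈ y) → x = y) (φ : SF) :
    ∀ v : ℕ → ZFSet.{u}, (∀ i, v i ∈ N) →
      (SatIn ∅ N φ v ↔ SatIn ∅ (clp N '' N) φ (fun i => clp N (v i))) := by
  induction φ with
  | mem i j =>
    intro v hv
    refine ⟨fun h => (mem_clp _ _ _).2 ⟨_, h, hv i, rfl⟩, fun h => ?_⟩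
    obtain ⟨y, h1, h2, h3⟩ := (mem_clp _ _ _).1 h
    have := clp_inj hN y h2 _ (hv i) h3
    subst this
    exact h1
  | eq i j =>
    intro v hv
    exact ⟨fun h => congrArg (clp N) h, fun h => clp_inj hN _ (hv i) _ (hv j) h⟩
  | pred i => intro v hv; exact Iff.rfl
  | not φ ih => intro v hv; exact not_congr (ih v hv)
  | and φ ψ ih1 ih2 => intro v hv; exact and_congr (ih1 v hv) (ih2 v hv)
  | ex k φ ih =>
    intro v hv
    have hu : ∀ x ∈ N, (SatIn ∅ N φ (Function.update v k x) ↔ SatIn ∅ (clp N '' N) φ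
        (Function.update (fun i => clp N (v i)) k (clp N x))) := by
      intro x hx
      rw [ih]
      · have : (fun i => clp N (Function.update v k x i)) =
            Function.update (fun i => clp N (v i)) k (clp N x) := by
          funext i
          by_cases hi : i = k
          · subst hi; simp
          · simp [Function.update_of_ne hi]
        rw [this]
      · intro i
        by_cases hi : i = k
        · subst hi; simpa using hx
        · rw [Function.update_of_ne hi]; exact hv i
    constructor
    · rintro ⟨x, hx, h⟩
      exact ⟨_, ⟨x, hx, rfl⟩, (hu x hx).1 h⟩
    · rintro ⟨_, ⟨x, hx, rfl⟩, h⟩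
      exact ⟨x, hx, (hu x hx).2 h⟩

theorem upd_mem {S : Set ZFSet.{u}} {v : ℕ → ZFSet.{u}} (hv : ∀ i, v i ∈ S) (k : ℕ) {x}
    (hx : x ∈ S) : ∀ i, Function.update v k x i ∈ S := by
  intro i
  by_cases hi : i = k
  · subst hi; simpa using hx
  · rw [Function.update_of_ne hi]; exact hv i

theorem delta_abs {φ : SF} (h : IsDeltaZero φ) {S : Set ZFSet.{u}}
    (hS : ∀ x ∈ S, ∀ y ∈ x, y ∈ S) : ∀ v : ℕ → ZFSet.{u}, (∀ i, v i ∈ S) →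
      (SatIn ∅ S φ v ↔ SatIn ∅ Set.univ φ v) := by
  induction h with
  | mem i j => intro v _; exact Iff.rfl
  | eq i j => intro v _; exact Iff.rfl
  | pred i => intro v _; exact Iff.rfl
  | not _ ih => intro v hv; exact not_congr (ih v hv)
  | and _ _ ih1 ih2 => intro v hv; exact and_congr (ih1 v hv) (ih2 v hv)
  | bex k j _ ih =>
    intro v hv
    constructor
    · rintro ⟨x, hx, h1, h2⟩
      exact ⟨x, trivial, h1, (ih _ (upd_mem hv k hx)).1 h2⟩
    · rintro ⟨x, -, h1, h2⟩
      have h1' : Function.update v k x k ∈ Function.update v k x j := h1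
      have hx : x ∈ S := by
        by_cases hj : j = k
        · subst hj; simp [ZFSet.mem_irrefl] at h1'
        · rw [Function.update_self, Function.update_of_ne hj] at h1'
          exact hS _ (hv j) _ h1'
      exact ⟨x, hx, h1, (ih _ (upd_mem hv k hx)).2 h2⟩

theorem sigma1_inv {φ : SF} (h : IsSigma 1 φ) :
    IsDeltaZero φ ∨ ∃ k ψ, φ = .ex k ψ ∧ IsSigma 1 ψ := by
  cases h with
  | of_pi h => cases h with | of_zero h => exact .inl h
  | ex k h => exact .inr ⟨k, _, rfl, h⟩

theorem sigma2_inv {φ : SF} (h : IsSigma 2 φ) :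
    (∃ ψ, φ = .not ψ ∧ IsSigma 1 ψ) ∨ ∃ k ψ, φ = .ex k ψ ∧ IsSigma 2 ψ := by
  cases h with
  | of_pi h => cases h with | not h => exact .inl ⟨_, rfl, h⟩
  | ex k h => exact .inr ⟨k, _, rfl, h⟩

theorem sigma1_up {S S' : Set ZFSet.{u}} (hS : ∀ x ∈ S, ∀ y ∈ x, y ∈ S)
    (hS' : ∀ x ∈ S', ∀ y ∈ x, y ∈ S') (hs : S ⊆ S') (φ : SF) : IsSigma 1 φ →
    ∀ v : ℕ → ZFSet.{u}, (∀ i, v i ∈ S) → SatIn ∅ S φ v → SatIn ∅ S' φ v := by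
  induction φ with
  | ex k φ ih =>
    intro h v hv hsat
    rcases sigma1_inv h with h | ⟨k', ψ, e, h⟩
    · exact (delta_abs h hS' v fun i => hs (hv i)).2 ((delta_abs h hS v hv).1 hsat)
    · cases e
      obtain ⟨x, hx, h2⟩ := hsat
      exact ⟨x, hs hx, ih h _ (upd_mem hv k hx) h2⟩
  | _ =>
    intro h v hv hsat
    rcases sigma1_inv h with h | ⟨k', ψ, e, h⟩
    · exact (delta_abs h hS' v fun i => hs (hv i)).2 ((delta_abs h hS v hv).1 hsat)
    · cases e

/-- the closure condition making `V_μ` a Σ₁-correct class -/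
def Clo (μ : Ordinal.{u}) : Prop := Ordinal.omega0 < μ ∧
  ∀ t ∈ Vclass μ, ∃ l ∈ Vclass μ, ZOrd l ∧ ¬ card l ≤ card t

theorem Clo.succ {μ : Ordinal.{u}} (h : Clo μ) {γ} (hγ : γ < μ) : succ γ < μ := by
  obtain ⟨l, h1, h2, h3⟩ := h.2 γ.toZFSet (by simpa [Vclass] using hγ)
  have h1 : rank l < μ := h1
  refine lt_of_le_of_lt (succ_le_of_lt ?_) h1
  by_contra hc
  rw [not_lt] at hc
  apply h3
  rw [← zord_rank h2, Ordinal.card_toZFSet, Ordinal.card_toZFSet]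
  exact Ordinal.card_le_card hc

theorem sigma1_down {μ : Ordinal.{u}} (h : Clo μ) {φ : SF} (hφ : IsSigma 1 φ)
    (v : ℕ → ZFSet.{u}) (hv : ∀ i, v i ∈ Vclass μ) (hs : SatIn ∅ Set.univ φ v) :
    SatIn ∅ (Vclass μ) φ v := by
  obtain ⟨n, hn⟩ := fv_bdd φ
  let w : ℕ → ZFSet.{u} := fun i => if i < n then v i else ∅
  have hvw : ∀ i ∈ φ.fv, v i = w i := fun i hi => by simp [w, hn i hi]
  rw [sat_congr _ _ v w hvw] at hs ⊢
  have hb : ∃ γ, Ordinal.omega0 ≤ γ ∧ γ < μ ∧ ∀ i < n, rank (v i) < γ := by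
    clear hn hvw hs w
    induction n with
    | zero => exact ⟨_, le_rfl, h.1, fun i hi => absurd hi (Nat.not_lt_zero i)⟩
    | succ n ih =>
      obtain ⟨γ, h1, h2, h3⟩ := ih
      refine ⟨max γ (Order.succ (rank (v n))), h1.trans (le_max_left _ _),
        max_lt h2 (h.succ (hv n)), fun i hi => ?_⟩
      rcases Nat.lt_succ_iff_lt_or_eq.1 hi with hi | rfl
      · exact (h3 i hi).trans_le (le_max_left _ _)
      · exact (lt_succ _).trans_le (le_max_right _ _)
  obtain ⟨γ, g1, g2, g3⟩ := hb
  have hw : ∀ i, w i ∈ V_ γ := by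
    intro i
    rw [mem_vonNeumann]
    by_cases hi : i < n
    · simpa [w, hi] using g3 i hi
    · simpa [w, hi] using Ordinal.omega0_pos.trans_le g1
  have hinf : ℵ₀ ≤ card (V_ γ) := by
    refine le_trans ?_ (Ordinal.card_le_card_vonNeumann γ)
    rw [← Ordinal.card_omega0]
    exact Ordinal.card_le_card g1
  obtain ⟨N, N1, N2, N3⟩ := exists_hull (V_ γ) hinf
  have hNs : Small.{u} N := by
    have e : #N ≤ #(V_ γ : ZFSet.{u}) := N2.trans_eq cardinalMk_coe_sort.symm
    obtain ⟨f⟩ := e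
    exact small_of_injective f.injective
  have hext : ∀ x ∈ N, ∀ y ∈ N, (∀ z ∈ N, z ∈ x ↔ z ∈ y) → x = y := by
    have key : ∀ x ∈ N, ∀ y ∈ N, (∀ z ∈ N, z ∈ x → z ∈ y) → x ⊆ y := by
      intro x hx y hy hz z hzx
      by_contra hzy
      have hm : ∀ i, cons x (fun _ => y) i ∈ N := cons_mem hx fun _ => hy
      obtain ⟨z', h1, h2, h3⟩ := (N3 (.ex 2 (.and (.mem 2 0) (.not (.mem 2 1)))) _ hm).2
        ⟨z, trivial, by simpa [Sat, cons] using hzx, by simpa [Sat, cons] using hzy⟩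
      have h2 : z' ∈ x := by simpa [Sat, cons] using h2
      have h3 : z' ∉ y := by simpa [Sat, cons] using h3
      exact h3 (hz z' h1 h2)
    intro x hx y hy hz
    exact ZFSet.ext fun z => ⟨fun h => key x hx y hy (fun z hz' => (hz z hz').1) h,
      fun h => key y hy x hx (fun z hz' => (hz z hz').2) h⟩
  have hcl := clp_id (isTransitive_vonNeumann γ) N1
  let M : ZFSet.{u} := range (fun y : N => clp N y.1)
  have hM : ∀ x, x ∈ M ↔ x ∈ clp N '' N := by
    intro x
    rw [mem_range]
    exact ⟨fun ⟨y, e⟩ => ⟨y.1, y.2, e⟩, fun ⟨y, h1, e⟩ => ⟨⟨y, h1⟩, e⟩⟩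
  have hMt : ∀ x ∈ clp N '' N, ∀ y ∈ x, y ∈ clp N '' N := by
    rintro _ ⟨x, hx, rfl⟩ y hy
    obtain ⟨z, -, h2, rfl⟩ := (mem_clp _ _ _).1 hy
    exact ⟨z, h2, rfl⟩
  have hMtr : M.IsTransitive := fun x hx y hy => (hM y).2 (hMt x ((hM x).1 hx) y hy)
  have hMc : card M ≤ card (V_ γ) := by
    have := lift_card_range_le (f := fun y : N => clp N y.1)
    have := this.trans (lift_le.2 N2)
    simpa using this
  have hMs : clp N '' N ⊆ Vclass μ := by
    obtain ⟨l, l1, l2, l3⟩ := h.2 (V_ γ) (by simpa [Vclass] using g2)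
    intro x hx
    refine lt_trans (lt_trans (rank_lt_of_mem ((hM x).2 hx)) ?_) (show rank l < μ from l1)
    by_contra hc
    rw [not_lt] at hc
    apply l3
    rw [← zord_rank l2, Ordinal.card_toZFSet]
    exact ((Ordinal.card_le_card hc).trans (card_rank_le hMtr)).trans hMc
  have s1 := (clp_sat hext φ w fun i => N1 _ (hw i)).1 ((N3 φ w fun i => N1 _ (hw i)).2 hs)
  have s2 := sigma1_up hMt (tc_V μ).1 hMs φ hφ _ (fun i => ⟨w i, N1 _ (hw i), rfl⟩) s1
  have : (fun i => clp N (w i)) = w := funext fun i => hcl _ (hw i)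
  rwa [this] at s2

theorem sigma2_up {μ : Ordinal.{u}} (h : Clo μ) (φ : SF) : IsSigma 2 φ →
    ∀ v : ℕ → ZFSet.{u}, (∀ i, v i ∈ Vclass μ) → SatIn ∅ (Vclass μ) φ v →
      SatIn ∅ Set.univ φ v := by
  induction φ with
  | ex k φ ih =>
    intro hφ v hv hs
    rcases sigma2_inv hφ with ⟨ψ, e, _⟩ | ⟨k', ψ, e, h2⟩
    · cases e
    · cases e
      obtain ⟨x, hx, h3⟩ := hs
      exact ⟨x, trivial, ih h2 _ (upd_mem hv k hx) h3⟩
  | not φ ih =>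
    intro hφ v hv hs
    rcases sigma2_inv hφ with ⟨ψ, e, h2⟩ | ⟨k', ψ, e, h2⟩
    · cases e
      exact fun hc => hs (sigma1_down h h2 v hv hc)
    · cases e
  | _ =>
    intro hφ v hv hs
    rcases sigma2_inv hφ with ⟨ψ, e, h2⟩ | ⟨k', ψ, e, h2⟩ <;> cases e

theorem sigma2_down (φ : SF) : IsSigma 2 φ →
    ∀ v : ℕ → ZFSet.{u}, SatIn ∅ Set.univ φ v → ∃ ρ : Ordinal.{u}, ∀ β, ρ < β →
      (∀ i, v i ∈ Vclass β) → SatIn ∅ (Vclass β) φ v := by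
  induction φ with
  | ex k φ ih =>
    intro hφ v hs
    rcases sigma2_inv hφ with ⟨ψ, e, _⟩ | ⟨k', ψ, e, h2⟩
    · cases e
    · cases e
      obtain ⟨x, -, h3⟩ := hs
      obtain ⟨ρ, hρ⟩ := ih h2 _ h3
      refine ⟨max ρ (rank x), fun β hβ hv => ?_⟩
      have hx : x ∈ Vclass β := (le_max_right _ _).trans_lt hβ
      exact ⟨x, hx, hρ β ((le_max_left _ _).trans_lt hβ) (upd_mem hv k hx)⟩
  | not φ ih =>
    intro hφ v hs
    rcases sigma2_inv hφ with ⟨ψ, e, h2⟩ | ⟨k', ψ, e, h2⟩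
    · cases e
      refine ⟨0, fun β _ hv hc => hs ?_⟩
      exact sigma1_up (tc_V β).1 (fun _ _ _ _ => trivial) (fun _ _ => trivial) φ h2 v hv hc
    · cases e
  | _ =>
    intro hφ v hs
    rcases sigma2_inv hφ with ⟨ψ, e, h2⟩ | ⟨k', ψ, e, h2⟩ <;> cases e

theorem backward {κ : ZFSet.{u}} (hw : WeaklyShrewd κ) (hr : RHS κ) : ¬ Shrewd κ := by
  intro hsh
  obtain ⟨δ, hδ, hκδ, φ, z, hfv, hφ, hz, hdef⟩ := hr
  have ic := ic_of_infCard hw.1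
  have hκ : (rank κ).toZFSet = κ := zord_rank hw.1.1.1
  have hzr : rank z < rank κ := rank_of_hset (by rwa [hκ])
  have hD : Dfn.{u} Nice (fun S v => (∀ t ∈ S, ∃ l ∈ S, ZOrd l ∧ ¬ card l ≤ card t) ∧
      ((∃ y ∈ v 1, y = y) ∧ ∀ y ∈ v 1, ∃ y' ∈ v 1, y ∈ y') ∧
      ∃ w ∈ v 0, ∃ x ∈ S, SatIn ∅ S φ (fun i => cons x (cons w v) (rcons 0 (fun _ => 1) i))) := by
    refine Dfn.and ?_ (Dfn.and (Dfn.and ?_ ?_) ?_)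
    · exact ((((dfn_ord 0).mono ntc).and (dfn_card 0 1).not).ex).all
    · exact (Dfn.eq 0 0).bex ntc 1
    · exact ((Dfn.mem 1 0).bex ntc 2).ball ntc 1
    · exact ((Dfn.of (Def.sat φ (rcons 0 (fun _ => 1)))).ex).bex ntc 0
  have hval : ∀ (S : Set ZFSet.{u}) (x w : ZFSet.{u}) (v : ℕ → ZFSet.{u}),
      SatIn ∅ S φ (fun i => cons x (cons w v) (rcons 0 (fun _ => 1) i)) ↔
      SatIn ∅ S φ (val2 x w) := by
    intro S x w v
    refine sat_congr _ _ _ _ fun i hi => ?_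
    rcases hfv hi with rfl | rfl <;> rfl
  simp only [hval] at hD
  obtain ⟨Φ, Φ1, Φ2⟩ := hD.nice.formula
  obtain ⟨ρ, hρ⟩ := sigma2_down φ hφ _ ((hdef δ).2 rfl)
  obtain ⟨β, hβ, hB⟩ := exists_big (max ρ (rank δ))
  have b1 : ρ < β := (le_max_left _ _).trans_lt hβ
  have b2 : rank δ < β := (le_max_right _ _).trans_lt hβ
  have b3 : rank κ < β := (rank_lt_of_mem hκδ).trans b2
  have hval2 : ∀ {μ : Ordinal.{u}} {x w : ZFSet.{u}}, rank x < μ → rank w < μ →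
      ∀ i, val2 x w i ∈ Vclass μ := by
    intro μ x w hx hw i
    unfold val2
    split_ifs
    · exact hx
    · exact hw
    · show rank ∅ < μ
      rw [rank_empty]
      exact (zero_le).trans_lt hx
  obtain ⟨κ', α', k1, a1, hs⟩ := hsh.2 Φ (β - rank κ).toZFSet {z} Φ1 (zord_toZFSet _)
    (by intro y hy; rw [mem_singleton] at hy; rwa [hy]) (by
      rw [Ordinal.rank_toZFSet, Ordinal.add_sub_cancel_of_le b3.le]
      refine (Φ2 _ (tc_V β) _ _).2 ⟨?_, b3, hB.nice, hB.closed, ⟨?_, ?_⟩, z, ?_, δ, b2, ?_⟩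
      · show rank {z} < β
        rw [rank_singleton]
        exact (succ_le_of_lt hzr).trans_lt b3
      · refine ⟨∅, ?_, trivial⟩
        show ∅ ∈ κ
        exact hw.1.2 omega_zero
      · intro y hy
        have hy : y ∈ κ := hy
        refine ⟨(Order.succ (rank y)).toZFSet, ?_, ?_⟩
        · show _ ∈ κ
          rw [← hκ, Ordinal.mem_toZFSet_iff]
          exact ⟨_, ic.succ (rank_lt_of_mem hy), rfl⟩
        · rw [Ordinal.mem_toZFSet_iff]
          refine ⟨rank y, lt_succ _, ?_⟩
          rw [← hκ, Ordinal.mem_toZFSet_iff] at hy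
          obtain ⟨a, _, rfl⟩ := hy
          rw [Ordinal.rank_toZFSet]
      · exact mem_singleton.2 rfl
      · exact hρ β b1 (hval2 b2 (hzr.trans b3)))
  obtain ⟨-, m1, hnice, hclo, ⟨⟨y0, hy0, -⟩, hlim⟩, w, hw0, x, hx, hsat⟩ := (Φ2 _ (tc_V _) _ _).1 hs
  set μ := rank κ' + rank α' with hμ
  have hμk : μ < rank κ := ic.add (rank_lt_of_mem k1) (rank_lt_of_mem a1)
  have hy0 : y0 ∈ κ' := hy0
  have hlim : ∀ y ∈ κ', ∃ y' ∈ κ', y ∈ y' := hlim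
  have m1 : rank κ' < μ := m1
  have hx : rank x < μ := hx
  have hω : Ordinal.omega0 < μ := by
    refine lt_of_le_of_lt ?_ m1
    rw [Ordinal.omega0_le]
    have : ∀ n : ℕ, ∃ y ∈ κ', (n : Ordinal.{u}) ≤ rank y := by
      intro n
      induction n with
      | zero => exact ⟨y0, hy0, by simp⟩
      | succ n ih =>
        obtain ⟨y, h1, h2⟩ := ih
        obtain ⟨y', h3, h4⟩ := hlim y h1
        refine ⟨y', h3, ?_⟩
        push_cast
        exact succ_le_of_lt (h2.trans_lt (rank_lt_of_mem h4))
    intro n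
    obtain ⟨y, h1, h2⟩ := this n
    exact h2.trans (rank_lt_of_mem h1).le
  have hwz : w = z := by
    have hw0 : w ∈ Vres {z} κ' := hw0
    exact mem_singleton.1 (mem_sep.1 hw0).1
  have hzμ : rank z < μ := by
    have hw0 : w ∈ Vres {z} κ' := hw0
    exact hwz ▸ (mem_sep.1 hw0).2.trans m1
  subst hwz
  have := (hdef x).1 (sigma2_up ⟨hω, hclo⟩ φ hφ _ (hval2 hx hzμ) hsat)
  subst this
  exact absurd (hx.trans hμk) (rank_lt_of_mem hκδ).not_gt

end WS

/-- A weakly shrewd cardinal `κ` is not shrewd if and only if there exists a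
cardinal `δ > κ` such that `{δ}` is definable by a Σ₂-formula with parameters
in `H(κ)`. -/
theorem weaklyShrewd_not_shrewd_iff (κ : ZFSet.{u}) (h : WeaklyShrewd κ) :
    ¬ Shrewd κ ↔
      ∃ δ : ZFSet.{u}, ZCard δ ∧ κ ∈ δ ∧
        ∃ (φ : SF) (z : ZFSet.{u}), φ.fv ⊆ {0, 1} ∧ IsSigma 2 φ ∧ z ∈ HSet κ ∧
          ∀ x : ZFSet.{u}, SatIn ∅ Set.univ φ (val2 x z) ↔ x = δ := by
  exact ⟨fun hns => by_contra fun hr => hns (WS.forward h hr), fun hr => WS.backward h hr⟩
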